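/- arXiv:2204.00782 — 3 statements merged into one kernel-verified Lean document; each statement's English description precedes it below -/
import Mathlib

section
/- Let U₀, U₁ be nonempty convex subsets of a (locally convex Hausdorff) normed space, with U₀ = U. Let Γ₀ : U₀ → 2^{U₁} and Γ₁ : U₁ → 2^{U₀} be upper semicontinuous set-valued maps with nonempty convex compact values, and let Γ = Γ₁ ∘ Γ₀ : U → 2^U. If the closure of Γ(U) is compact, then Γ has a fixed point: there exists u ∈ U with u ∈ Γ(u). -/
open Filter Topology Set

theorem pair_collision {α β : Type*} [DecidableEq α] [DecidableEq β] (s : Finset α) (f : α → β)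
    (h : (s.image f).card + 1 = s.card) :
    ∃ p ∈ s, ∃ q ∈ s, p ≠ q ∧ f p = f q ∧ Set.InjOn f (s.erase p : Finset α) ∧
      Set.InjOn f (s.erase q : Finset α) := by
  have hlt : (s.image f).card < s.card := by omega
  obtain ⟨p, hp, q, hq, hpq, hf⟩ := Finset.exists_ne_map_eq_of_card_lt_of_maps_to hlt
    (fun a ha => Finset.mem_image_of_mem f ha)
  have key : ∀ p ∈ s, ∀ q ∈ s, p ≠ q → f p = f q → Set.InjOn f (s.erase p : Finset α) := by
    intro p hp q hq hpq hf
    rw [← Finset.card_image_iff]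
    have : (s.erase p).image f = s.image f := by
      apply Finset.Subset.antisymm (Finset.image_subset_image (Finset.erase_subset _ _))
      intro y hy
      obtain ⟨x, hx, rfl⟩ := Finset.mem_image.1 hy
      by_cases hxp : x = p
      · subst hxp
        rw [hf]
        exact Finset.mem_image_of_mem f (Finset.mem_erase.2 ⟨hpq.symm, hq⟩)
      · exact Finset.mem_image_of_mem f (Finset.mem_erase.2 ⟨hxp, hx⟩)
    rw [this, Finset.card_erase_of_mem hp]
    omega
  exact ⟨p, hp, q, hq, hpq, hf, key p hp q hq hpq hf, key q hq p hp hpq.symm hf.symm⟩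

/-- Dominance for a finite family of injective utilities. -/
def ScDom {I Y : Type*} (r : I → Y → ℤ) (σ : Finset Y) : Prop :=
  ∀ y, ∃ i, ∀ x ∈ σ, r i y ≤ r i x

/-- The pivot element of type `k`. -/
def ScT {I Y : Type*} (r : I → Y → ℤ) (m : I → Y) (k : I) (x : Y) : Prop :=
  (∀ l, l ≠ k → r l (m l) < r l x) ∧
    ∀ y, (∀ l, l ≠ k → r l (m l) < r l y) → r k y ≤ r k x

section door
variable {I Y : Type*} [Fintype I] [DecidableEq I] [Fintype Y] [DecidableEq Y]

theorem ScT_exists (r : I → Y → ℤ) (m : I → Y) (k : I) (h : ∃ y, ∀ l, l ≠ k → r l (m l) < r l y) :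
    ∃ x, ScT r m k x := by
  classical
  obtain ⟨y, hy⟩ := h
  obtain ⟨x, hx, hmax⟩ := Finset.exists_max_image
    (Finset.univ.filter fun y => ∀ l, l ≠ k → r l (m l) < r l y) (r k) ⟨y, by simpa using hy⟩
  refine ⟨x, by simpa using hx, fun y hy => hmax y (by simpa using hy)⟩

theorem ScT_le (r : I → Y → ℤ) (m : I → Y) (k : I) (x : Y) (τ : Finset Y)
    (hm : ∀ l, m l ∈ τ) (hd : ScDom r τ) (h : ScT r m k x) : r k x ≤ r k (m k) := by
  obtain ⟨l, hl⟩ := hd x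
  by_cases hlk : l = k
  · subst hlk; exact hl _ (hm _)
  · exact absurd (hl _ (hm l)) (not_le.2 (h.1 l hlk))

/-- Structure of the rooms adjacent to a door. -/
theorem door_struct (r : I → Y → ℤ) (hr : ∀ i, Function.Injective (r i))
    (τ : Finset Y) (hτ : τ.card + 1 = Fintype.card I) (hne : τ.Nonempty) (hd : ScDom r τ)
    (m : I → Y) (hm : ∀ l, m l ∈ τ) (hmin : ∀ l, ∀ x ∈ τ, r l (m l) ≤ r l x) :
    ∃ p q, p ≠ q ∧ m p = m q ∧ (∀ k l, k ≠ l → m k = m l → k = p ∨ k = q) ∧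
      (∀ x, (x ∉ τ ∧ ScDom r (insert x τ)) ↔ (ScT r m p x ∨ ScT r m q x)) ∧
      ∀ x, ¬ (ScT r m p x ∧ ScT r m q x) := by
  have himg : Finset.univ.image m = τ := by
    apply Finset.Subset.antisymm
    · intro y hy
      obtain ⟨l, -, rfl⟩ := Finset.mem_image.1 hy
      exact hm l
    · intro z hz
      obtain ⟨l, hl⟩ := hd z
      have : m l = z := hr l (le_antisymm (hmin l z hz) (hl _ (hm l)))
      exact Finset.mem_image.2 ⟨l, Finset.mem_univ _, this⟩
  obtain ⟨p, -, q, -, hpq, hmpq, hip, hiq⟩ := pair_collision Finset.univ m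
    (by rw [himg, hτ, Finset.card_univ])
  have hcol : ∀ k l, k ≠ l → m k = m l → k = p ∨ k = q := by
    intro k l hkl he
    by_contra hcon
    push Not at hcon
    by_cases hlp : l = p
    · apply hkl
      exact hiq (by simp [hcon.2]) (by simp [hlp, hpq]) he
    · apply hkl
      exact hip (by simp [hcon.1]) (by simp [hlp]) he
  refine ⟨p, q, hpq, hmpq, hcol, ?_, ?_⟩
  · intro x
    constructor
    · rintro ⟨hx, hdx⟩
      obtain ⟨k, hk⟩ := hdx x
      have hz : ∀ z ∈ τ, ∃ l, l ≠ k ∧ m l = z ∧ r l z < r l x := by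
        intro z hz
        obtain ⟨l, hl⟩ := hdx z
        have hzx : z ≠ x := fun h => hx (h ▸ hz)
        have h1 : r l z ≤ r l x := hl x (Finset.mem_insert_self _ _)
        have h2 : r l z ≠ r l x := fun h => hzx (hr l h)
        refine ⟨l, ?_, ?_, lt_of_le_of_ne h1 h2⟩
        · rintro rfl
          exact h2 (le_antisymm h1 (hk z (Finset.mem_insert_of_mem hz)))
        · exact hr l (le_antisymm (hmin l z hz) (hl _ (Finset.mem_insert_of_mem (hm l))))
      have hkpq : k = p ∨ k = q := by
        obtain ⟨l, hl, hml, -⟩ := hz (m k) (hm k)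
        exact hcol k l hl.symm hml.symm
      have hik : Set.InjOn m ((Finset.univ.erase k : Finset I)) := by
        rcases hkpq with rfl | rfl <;> assumption
      have hT : ScT r m k x := by
        constructor
        · intro l hl
          obtain ⟨l', hl', hml', hlt⟩ := hz (m l) (hm l)
          have : l' = l := hik (by simp [hl']) (by simp [hl]) hml'
          rw [this] at hlt
          exact hlt
        · intro y hy
          obtain ⟨l, hl⟩ := hdx y
          by_cases hlk : l = k
          · subst hlk; exact hl _ (Finset.mem_insert_self _ _)
          · exact absurd (hl _ (Finset.mem_insert_of_mem (hm l))) (not_le.2 (hy l hlk))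
      rcases hkpq with rfl | rfl
      · exact Or.inl hT
      · exact Or.inr hT
    · intro h
      have key : ∀ k k', k ≠ k' → m k = m k' → ScT r m k x → x ∉ τ ∧ ScDom r (insert x τ) := by
        intro k k' hkk hmk hT
        have hle := ScT_le r m k x τ hm hd hT
        constructor
        · intro hx
          have h1 : x = m k := hr k (le_antisymm hle (hmin k x hx))
          have h2 := hT.1 k' hkk.symm
          rw [h1, hmk] at h2
          exact lt_irrefl _ h2
        · intro y
          by_cases hy : ∀ l, l ≠ k → r l (m l) < r l y
          · refine ⟨k, fun z hz => ?_⟩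
            have := hT.2 y hy
            rcases Finset.mem_insert.1 hz with rfl | hz
            · exact this
            · exact this.trans (hle.trans (hmin k z hz))
          · push Not at hy
            obtain ⟨l, hl, hyl⟩ := hy
            refine ⟨l, fun z hz => ?_⟩
            rcases Finset.mem_insert.1 hz with rfl | hz
            · exact hyl.trans (hT.1 l hl).le
            · exact hyl.trans (hmin l z hz)
      rcases h with h | h
      · exact key p q hpq hmpq h
      · exact key q p hpq.symm hmpq.symm h
  · rintro x ⟨h1, h2⟩
    exact absurd (ScT_le r m q x τ hm hd h2) (not_le.2 (h1.1 q hpq.symm))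

theorem ScT_unique (r : I → Y → ℤ) (hr : ∀ i, Function.Injective (r i)) (m : I → Y) (k : I)
    (x x' : Y) (h : ScT r m k x) (h' : ScT r m k x') : x = x' :=
  hr k (le_antisymm (h'.2 x h.1) (h.2 x' h'.1))

theorem scarf_aux [Nontrivial I] (r : I → Y → ℤ) (hr : ∀ i, Function.Injective (r i))
    (s : I → Y) (hs : Function.Injective s)
    (ha : ∀ i y, y ≠ s i → r i (s i) < r i y)
    (hb : ∀ i j y, y ∉ Set.range s → j ≠ i → r i y < r i (s j))
    (hX : ∃ y, y ∉ Set.range s)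
    (c : Y → I) (hc : ∀ i, c (s i) = i) :
    ∃ σ : Finset Y, (∀ i, ∃ x ∈ σ, c x = i) ∧ ScDom r σ := by
  classical
  by_contra hno
  push Not at hno
  obtain ⟨i0⟩ : Nonempty I := inferInstance
  have hn2 : 2 ≤ Fintype.card I := Fintype.one_lt_card
  let D : Finset (Finset Y) := Finset.univ.filter fun τ =>
    τ.card + 1 = Fintype.card I ∧ τ.image c = Finset.univ.erase i0 ∧ ScDom r τ
  let R : Finset (Finset Y) := Finset.univ.filter fun σ =>
    σ.card = Fintype.card I ∧ σ.image c = Finset.univ.erase i0 ∧ ScDom r σ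
  let τ0 : Finset Y := (Finset.univ.erase i0).image s
  have hDmem : ∀ τ, τ ∈ D ↔ (τ.card + 1 = Fintype.card I ∧ τ.image c = Finset.univ.erase i0 ∧
    ScDom r τ) := fun τ => by simp [D]
  have hRmem : ∀ τ, τ ∈ R ↔ (τ.card = Fintype.card I ∧ τ.image c = Finset.univ.erase i0 ∧
    ScDom r τ) := fun τ => by simp [R]
  have hcardE : (Finset.univ.erase i0 : Finset I).card + 1 = Fintype.card I := by
    rw [Finset.card_erase_of_mem (Finset.mem_univ _), Finset.card_univ]; omega
  have hτ0 : τ0 ∈ D := by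
    rw [hDmem]
    refine ⟨?_, ?_, ?_⟩
    · rw [Finset.card_image_of_injective _ hs, hcardE]
    · rw [Finset.image_image]
      have : c ∘ s = id := funext hc
      rw [this, Finset.image_id]
    · intro y
      by_cases hy : y ∈ Set.range s
      · obtain ⟨j, rfl⟩ := hy
        refine ⟨j, fun x _ => ?_⟩
        by_cases hx : x = s j
        · rw [hx]
        · exact (ha j x hx).le
      · refine ⟨i0, fun x hx => ?_⟩
        obtain ⟨j, hj, rfl⟩ := Finset.mem_image.1 hx
        exact (hb i0 j y hy (Finset.ne_of_mem_erase hj)).le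
  -- rooms
  have hroom : ∀ σ ∈ R, (Finset.bipartiteBelow (fun τ σ : Finset Y => τ ⊆ σ) D σ).card = 2 := by
    intro σ hσ
    rw [hRmem] at hσ
    obtain ⟨h1, h2, h3⟩ := hσ
    obtain ⟨p, hp, q, hq, hpq, hcpq, hip, hiq⟩ := pair_collision σ c (by rw [h2, h1, hcardE])
    have hsub : ∀ z ∈ σ, Set.InjOn c (σ.erase z : Finset Y) → σ.erase z ∈ D := by
      intro z hz hinj
      have hcard : (σ.erase z).card + 1 = Fintype.card I := by
        rw [Finset.card_erase_of_mem hz, h1]; omega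
      rw [hDmem]
      refine ⟨hcard, ?_, ?_⟩
      · apply Finset.eq_of_subset_of_card_le
        · rw [← h2]; exact Finset.image_subset_image (Finset.erase_subset _ _)
        · rw [Finset.card_image_of_injOn hinj]; omega
      · intro y
        obtain ⟨i, hi⟩ := h3 y
        exact ⟨i, fun x hx => hi x (Finset.mem_of_mem_erase hx)⟩
    have : Finset.bipartiteBelow (fun τ σ : Finset Y => τ ⊆ σ) D σ = {σ.erase p, σ.erase q} := by
      ext τ
      rw [Finset.mem_bipartiteBelow, Finset.mem_insert, Finset.mem_singleton]
      constructor
      · rintro ⟨hτ, hsubs⟩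
        rw [hDmem] at hτ
        obtain ⟨t1, t2, t3⟩ := hτ
        have hinj : Set.InjOn c (τ : Finset Y) := by
          rw [← Finset.card_image_iff, t2]; omega
        by_cases hpτ : p ∈ τ
        · right
          apply Finset.eq_of_subset_of_card_le
          · intro x hx
            refine Finset.mem_erase.2 ⟨?_, hsubs hx⟩
            rintro rfl
            exact hpq (hinj hpτ hx hcpq)
          · rw [Finset.card_erase_of_mem hq]; omega
        · left
          apply Finset.eq_of_subset_of_card_le
          · intro x hx
            refine Finset.mem_erase.2 ⟨?_, hsubs hx⟩
            rintro rfl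
            exact hpτ hx
          · rw [Finset.card_erase_of_mem hp]; omega
      · rintro (rfl | rfl)
        · exact ⟨hsub p hp hip, Finset.erase_subset _ _⟩
        · exact ⟨hsub q hq hiq, Finset.erase_subset _ _⟩
    rw [this, Finset.card_pair]
    intro h
    have : p ∈ σ.erase p := by rw [h]; exact Finset.mem_erase.2 ⟨hpq, hp⟩
    exact (Finset.notMem_erase p σ) this
  -- doors
  have hAcard : ∀ τ ∈ D, (Finset.bipartiteAbove (fun τ σ : Finset Y => τ ⊆ σ) R τ).card =
      (Finset.univ.filter fun x => x ∉ τ ∧ ScDom r (insert x τ)).card := by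
    intro τ hτ
    rw [hDmem] at hτ
    obtain ⟨t1, t2, t3⟩ := hτ
    symm
    apply Finset.card_bij (fun x _ => insert x τ)
    · intro x hx
      simp only [Finset.mem_filter, Finset.mem_univ, true_and] at hx
      rw [Finset.mem_bipartiteAbove, hRmem]
      refine ⟨⟨?_, ?_, hx.2⟩, Finset.subset_insert _ _⟩
      · rw [Finset.card_insert_of_notMem hx.1, t1]
      · rw [Finset.image_insert, t2, Finset.insert_eq_self]
        refine Finset.mem_erase.2 ⟨?_, Finset.mem_univ _⟩
        intro hcx
        apply hno (insert x τ) _ hx.2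
        intro i
        by_cases hi : i = i0
        · exact ⟨x, Finset.mem_insert_self _ _, hcx.trans hi.symm⟩
        · have : i ∈ τ.image c := by rw [t2]; simp [hi]
          obtain ⟨z, hz, hzi⟩ := Finset.mem_image.1 this
          exact ⟨z, Finset.mem_insert_of_mem hz, hzi⟩
    · intro x hx y hy hxy
      simp only [Finset.mem_filter, Finset.mem_univ, true_and] at hx hy
      have : x ∈ insert y τ := by rw [← hxy]; exact Finset.mem_insert_self _ _
      rcases Finset.mem_insert.1 this with h | h
      · exact h
      · exact absurd h hx.1
    · intro σ hσ
      rw [Finset.mem_bipartiteAbove, hRmem] at hσ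
      obtain ⟨⟨h1, h2, h3⟩, hsub⟩ := hσ
      have hcd : (σ \ τ).card = 1 := by
        rw [Finset.card_sdiff_of_subset hsub]; omega
      obtain ⟨x, hx⟩ := Finset.card_eq_one.1 hcd
      have hxm : x ∈ σ \ τ := by rw [hx]; simp
      have hins : insert x τ = σ := by
        rw [← Finset.sdiff_union_of_subset hsub, hx]; rfl
      refine ⟨x, ?_, hins⟩
      simp only [Finset.mem_filter, Finset.mem_univ, true_and]
      exact ⟨(Finset.mem_sdiff.1 hxm).2, by rw [hins]; exact h3⟩
  have hdoorgen : ∀ τ ∈ D, ∃ m : I → Y, (∀ l, m l ∈ τ) ∧ ∀ l, ∀ x ∈ τ, r l (m l) ≤ r l x := by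
    intro τ hτ
    rw [hDmem] at hτ
    have hne : τ.Nonempty := by rw [← Finset.card_pos]; omega
    choose m hm hmin using fun l => Finset.exists_min_image τ (r l) hne
    exact ⟨m, hm, hmin⟩
  have hdoor2 : ∀ τ ∈ D.erase τ0,
      (Finset.bipartiteAbove (fun τ σ : Finset Y => τ ⊆ σ) R τ).card = 2 := by
    intro τ hτ
    have hττ0 := Finset.ne_of_mem_erase hτ
    have hτD := Finset.mem_of_mem_erase hτ
    rw [hAcard τ hτD]
    obtain ⟨m, hm, hmin⟩ := hdoorgen τ hτD
    rw [hDmem] at hτD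
    obtain ⟨t1, t2, t3⟩ := hτD
    obtain ⟨p, q, hpq, hmpq, hcol, hA, hdisj⟩ := door_struct r hr τ t1 ⟨_, hm i0⟩ t3 m hm hmin
    have hex : ∀ k, ∃ x, ScT r m k x := by
      intro k
      apply ScT_exists
      refine ⟨s k, fun l hl => ?_⟩
      by_cases hms : m l ∈ Set.range s
      · obtain ⟨j, hj⟩ := hms
        by_cases hjl : j = l
        · subst hjl
          rw [← hj]
          exact ha _ _ (fun h => hl (hs h).symm)
        · exfalso
          have hsub : τ ⊆ (Finset.univ.erase l).image s := by
            intro z hz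
            have h1 := hmin l z hz
            rw [← hj] at h1
            by_cases hzs : z ∈ Set.range s
            · obtain ⟨a, rfl⟩ := hzs
              refine Finset.mem_image_of_mem s (Finset.mem_erase.2 ⟨?_, Finset.mem_univ _⟩)
              rintro rfl
              exact absurd h1 (not_le.2 (ha _ _ (fun h => hjl (hs h))))
            · exact absurd h1 (not_le.2 (hb l j z hzs hjl))
          have heq : τ = (Finset.univ.erase l).image s := by
            apply Finset.eq_of_subset_of_card_le hsub
            rw [Finset.card_image_of_injective _ hs,
              Finset.card_erase_of_mem (Finset.mem_univ _), Finset.card_univ]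
            omega
          have hl0 : l = i0 := by
            have h3 := t2
            rw [heq, Finset.image_image] at h3
            have : c ∘ s = id := funext hc
            rw [this, Finset.image_id] at h3
            by_contra hli
            have : l ∈ (Finset.univ.erase l : Finset I) := by rw [h3]; simp [hli]
            exact Finset.notMem_erase _ _ this
          rw [hl0] at heq
          exact hττ0 heq
      · exact hb l k (m l) hms (fun h => hl h.symm)
    obtain ⟨xp, hxp⟩ := hex p
    obtain ⟨xq, hxq⟩ := hex q
    have : (Finset.univ.filter fun x => x ∉ τ ∧ ScDom r (insert x τ)) = {xp, xq} := by
      ext x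
      simp only [Finset.mem_filter, Finset.mem_univ, true_and, Finset.mem_insert,
        Finset.mem_singleton]
      rw [hA]
      constructor
      · rintro (h | h)
        · exact Or.inl (ScT_unique r hr m p _ _ h hxp)
        · exact Or.inr (ScT_unique r hr m q _ _ h hxq)
      · rintro (rfl | rfl)
        · exact Or.inl hxp
        · exact Or.inr hxq
    rw [this, Finset.card_pair]
    rintro rfl
    exact hdisj _ ⟨hxp, hxq⟩
  have hdoor1 : (Finset.bipartiteAbove (fun τ σ : Finset Y => τ ⊆ σ) R τ0).card = 1 := by
    rw [hAcard τ0 hτ0]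
    obtain ⟨m, hm, hmin⟩ := hdoorgen τ0 hτ0
    have hτD := hτ0
    rw [hDmem] at hτD
    obtain ⟨t1, t2, t3⟩ := hτD
    obtain ⟨p, q, hpq, hmpq, hcol, hA, hdisj⟩ := door_struct r hr τ0 t1 ⟨_, hm i0⟩ t3 m hm hmin
    have hml : ∀ l, l ≠ i0 → m l = s l := by
      intro l hl
      by_contra h
      have h1 := hmin l (s l) (Finset.mem_image_of_mem s (by simp [hl]))
      exact absurd h1 (not_le.2 (ha l _ h))
    obtain ⟨p', hp', hmp'⟩ := Finset.mem_image.1 (hm i0)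
    have hp'0 : p' ≠ i0 := Finset.ne_of_mem_erase hp'
    have hcoll : m i0 = m p' := by rw [hml p' hp'0, hmp']
    have hA' : ∀ x, (x ∉ τ0 ∧ ScDom r (insert x τ0)) ↔ (ScT r m i0 x ∨ ScT r m p' x) := by
      intro x
      rw [hA]
      rcases hcol i0 p' hp'0.symm hcoll with h1 | h1 <;>
      rcases hcol p' i0 hp'0 hcoll.symm with h2 | h2
      · exact absurd (h2.trans h1.symm) hp'0
      · rw [h1, h2]
      · rw [h1, h2, or_comm]
      · exact absurd (h2.trans h1.symm) hp'0
    obtain ⟨x0, hx0⟩ := ScT_exists r m i0 (by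
      obtain ⟨y, hy⟩ := hX
      refine ⟨y, fun l hl => ?_⟩
      rw [hml l hl]
      exact ha l y (fun h => hy ⟨l, h.symm⟩))
    rw [Finset.card_eq_one]
    refine ⟨x0, ?_⟩
    ext x
    simp only [Finset.mem_filter, Finset.mem_univ, true_and, Finset.mem_singleton]
    rw [hA']
    constructor
    · rintro (h | h)
      · exact ScT_unique r hr m i0 _ _ h hx0
      · exfalso
        have h1 := h.1 i0 hp'0.symm
        rw [← hmp'] at h1
        by_cases hxs : x ∈ Set.range s
        · obtain ⟨j, rfl⟩ := hxs
          by_cases hj0 : j = i0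
          · subst hj0
            exact absurd h1 (not_lt.2 (ha _ _ (fun h => hp'0 (hs h))).le)
          · by_cases hjp : j = p'
            · subst hjp; exact lt_irrefl _ h1
            · have h2 := h.1 j hjp
              rw [hml j hj0] at h2
              exact lt_irrefl _ h2
        · exact absurd h1 (not_lt.2 (hb i0 p' x hxs hp'0).le)
    · rintro rfl
      exact Or.inl hx0
  have hcount := Finset.sum_card_bipartiteAbove_eq_sum_card_bipartiteBelow
    (fun τ σ : Finset Y => τ ⊆ σ) (s := D) (t := R)
  rw [Finset.sum_congr rfl hroom, ← Finset.add_sum_erase D _ hτ0, hdoor1,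
    Finset.sum_congr rfl hdoor2] at hcount
  simp only [Finset.sum_const, smul_eq_mul] at hcount
  omega

theorem scarf [Nonempty I] (r : I → Y → ℤ) (hr : ∀ i, Function.Injective (r i))
    (s : I → Y) (hs : Function.Injective s)
    (ha : ∀ i y, y ≠ s i → r i (s i) < r i y)
    (hb : ∀ i j y, y ∉ Set.range s → j ≠ i → r i y < r i (s j))
    (hX : ∃ y, y ∉ Set.range s)
    (c : Y → I) (hc : ∀ i, c (s i) = i) :
    ∃ σ : Finset Y, (∀ i, ∃ x ∈ σ, c x = i) ∧ ScDom r σ := by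
  rcases subsingleton_or_nontrivial I with h | h
  · obtain ⟨i0⟩ : Nonempty I := inferInstance
    obtain ⟨y0, -⟩ := hX
    obtain ⟨x, -, hx⟩ := Finset.exists_max_image (Finset.univ : Finset Y) (r i0)
      ⟨y0, Finset.mem_univ _⟩
    refine ⟨{x}, fun i => ⟨x, by simp, Subsingleton.elim _ _⟩, fun y => ⟨i0, ?_⟩⟩
    intro z hz
    rw [Finset.mem_singleton.1 hz]
    exact hx y (Finset.mem_univ _)
  · exact scarf_aux r hr s hs ha hb hX c hc
end door

/-- Grid points of the simplex with denominator `N`. -/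
abbrev ScGrid (I : Type*) [Fintype I] (N : ℕ) : Type _ :=
  {x : I → Fin (N + 1) // ∑ i, (x i : ℕ) = N}

/-- Perturbed coordinates on grid points and slack points. -/
def scR {I : Type*} [Fintype I] [DecidableEq I] (N M : ℕ) (e : ScGrid I N → Fin M) (d : I → ℕ)
    (i : I) : ScGrid I N ⊕ I → ℤ
  | Sum.inl x => ((x.1 i : ℕ) : ℤ) * M + ((e x : ℕ) : ℤ)
  | Sum.inr j => if j = i then -1 else ((N : ℤ) + 1) * M + d j

theorem scGrid_mk {I : Type*} [Fintype I] [DecidableEq I] [Nonempty I] (N : ℕ) (b : I → ℕ)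
    (hb : ∑ i, b i ≤ N) : ∃ y : ScGrid I N, ∀ i, b i ≤ (y.1 i : ℕ) := by
  obtain ⟨i1⟩ : Nonempty I := inferInstance
  let z : I → ℕ := fun i => b i + if i = i1 then N - ∑ i, b i else 0
  have hz : ∑ i, z i = N := by
    simp only [z, Finset.sum_add_distrib, Finset.sum_ite_eq', Finset.mem_univ, if_true]
    omega
  have hlt : ∀ i, z i < N + 1 := by
    intro i
    have := Finset.single_le_sum (f := z) (fun _ _ => Nat.zero_le _) (Finset.mem_univ i)
    omega
  exact ⟨⟨fun i => ⟨z i, hlt i⟩, hz⟩, fun i => Nat.le_add_right _ _⟩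

theorem scGrid_comb {I : Type*} [Fintype I] [DecidableEq I] [Nonempty I] (N : ℕ)
    (c : ScGrid I N → I) :
    ∃ S : Finset (ScGrid I N), S.Nonempty ∧
      (∀ x ∈ S, ∀ y ∈ S, ∀ i, (x.1 i : ℕ) ≤ (y.1 i : ℕ) + Fintype.card I) ∧
      ∀ i, (∃ x ∈ S, c x = i) ∨ ∀ x ∈ S, (x.1 i : ℕ) ≤ Fintype.card I := by
  classical
  let M := Fintype.card (ScGrid I N)
  let e : ScGrid I N ≃ Fin M := Fintype.equivFin _
  let d : I → ℕ := fun j => (Fintype.equivFin I j : ℕ)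
  have hd : Function.Injective d := fun a b h => (Fintype.equivFin I).injective (Fin.ext h)
  let r := scR N M e d
  have hM : ∀ x, ((e x : ℕ) : ℤ) < M := fun x => by exact_mod_cast (e x).2
  have hlt : ∀ (i : I) (x y : ScGrid I N), (x.1 i : ℕ) < (y.1 i : ℕ) →
      r i (Sum.inl x) < r i (Sum.inl y) := by
    intro i x y h
    simp only [r, scR]
    have h1 : ((x.1 i : ℕ) : ℤ) + 1 ≤ ((y.1 i : ℕ) : ℤ) := by exact_mod_cast h
    have h2 := mul_le_mul_of_nonneg_right h1 (Int.natCast_nonneg M)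
    have := hM x
    have h4 : (0 : ℤ) ≤ ((e y : ℕ) : ℤ) := Int.natCast_nonneg _
    linarith
  have hnn : ∀ (i : I) (x : ScGrid I N), 0 ≤ r i (Sum.inl x) := by
    intro i x
    simp only [r, scR]
    positivity
  have hbig : ∀ (i j : I) (x : ScGrid I N), j ≠ i → r i (Sum.inl x) < r i (Sum.inr j) := by
    intro i j x hj
    simp only [r, scR, if_neg hj]
    have h1 : ((x.1 i : ℕ) : ℤ) ≤ N := by
      have := (x.1 i).2
      exact_mod_cast Nat.lt_succ_iff.1 this
    have h2 := mul_le_mul_of_nonneg_right h1 (Int.natCast_nonneg M)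
    have := hM x
    have h4 : (0 : ℤ) ≤ (d j : ℤ) := Int.natCast_nonneg _
    linarith
  have hself : ∀ i, r i (Sum.inr i) = -1 := by intro i; simp [r, scR]
  have hpos : ∀ i j, j ≠ i → 0 ≤ r i (Sum.inr j) := by
    intro i j hj
    simp only [r, scR, if_neg hj]
    positivity
  have hinj : ∀ i, Function.Injective (r i) := by
    intro i
    rintro (x | j) (y | k) h
    · rcases lt_trichotomy (x.1 i : ℕ) (y.1 i : ℕ) with h1 | h1 | h1
      · exact absurd h (hlt i x y h1).ne
      · simp only [r, scR, h1] at h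
        have : (e x : ℕ) = e y := by
          have := add_left_cancel h
          exact_mod_cast this
        rw [e.injective (Fin.ext this)]
      · exact absurd h (hlt i y x h1).ne'
    · by_cases hk : k = i
      · subst hk
        have := hnn k x
        rw [h, hself] at this
        omega
      · exact absurd h (hbig i k x hk).ne
    · by_cases hk : j = i
      · subst hk
        have := hnn j y
        rw [← h, hself] at this
        omega
      · exact absurd h (hbig i j y hk).ne'
    · by_cases hj : j = i <;> by_cases hk : k = i
      · rw [hj, hk]
      · subst hj
        have := hpos j k hk
        rw [← h, hself] at this
        omega
      · subst hk
        have := hpos k j hj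
        rw [h, hself] at this
        omega
      · simp only [r, scR, if_neg hj, if_neg hk] at h
        have : d j = d k := by
          have := add_left_cancel h
          exact_mod_cast this
        rw [hd this]
  obtain ⟨σ, hcol, hdom⟩ := scarf r hinj Sum.inr Sum.inr_injective
    (by
      rintro i (x | j) hy
      · rw [hself]; have := hnn i x; omega
      · have hj : j ≠ i := fun h => hy (by rw [h])
        rw [hself]; have := hpos i j hj; omega)
    (by
      rintro i j (x | k) hy hj
      · exact hbig i j x hj
      · exact absurd ⟨k, rfl⟩ hy)
    (by
      obtain ⟨y, -⟩ := scGrid_mk (I := I) N (fun _ => 0) (by simp)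
      exact ⟨Sum.inl y, by simp⟩)
    (Sum.elim c id) (fun i => rfl)
  let S : Finset (ScGrid I N) := Finset.univ.filter fun x => Sum.inl x ∈ σ
  have hS : ∀ x, x ∈ S ↔ Sum.inl x ∈ σ := fun x => by simp [S]
  have hcolS : ∀ i, Sum.inr i ∉ σ → ∃ x ∈ S, c x = i := by
    intro i hi
    obtain ⟨x | j, hx, hxc⟩ := hcol i
    · exact ⟨x, (hS x).2 hx, hxc⟩
    · have : j = i := hxc
      exact absurd (this ▸ hx) hi
  have hSne : S.Nonempty := by
    by_contra hne
    rw [Finset.not_nonempty_iff_eq_empty] at hne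
    have hall : ∀ i, Sum.inr i ∈ σ := by
      intro i
      by_contra hi
      obtain ⟨x, hx, -⟩ := hcolS i hi
      rw [hne] at hx
      simp at hx
    obtain ⟨y, -⟩ := scGrid_mk (I := I) N (fun _ => 0) (by simp)
    obtain ⟨i, hi⟩ := hdom (Sum.inl y)
    have := hi _ (hall i)
    rw [hself] at this
    have := hnn i y
    omega
  choose w hwS hwmin using fun i => Finset.exists_min_image S (fun x => (x.1 i : ℕ)) hSne
  let b : I → ℕ := fun i => if Sum.inr i ∈ σ then 0 else ((w i).1 i : ℕ) + 1
  have hbN : N < ∑ i, b i := by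
    by_contra hle
    obtain ⟨y, hy⟩ := scGrid_mk N b (not_lt.1 hle)
    obtain ⟨i, hi⟩ := hdom (Sum.inl y)
    have hyi := hy i
    by_cases hσ : Sum.inr i ∈ σ
    · have := hi _ hσ
      rw [hself] at this
      have := hnn i y
      omega
    · simp only [b, if_neg hσ] at hyi
      have h1 := hi _ ((hS _).1 (hwS i))
      exact absurd h1 (not_le.2 (hlt i _ _ (by omega)))
  have hbx : ∀ x ∈ S, ∀ i, b i ≤ (x.1 i : ℕ) + 1 := by
    intro x hx i
    have := hwmin i x hx
    simp only [b]
    split_ifs <;> omega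
  have hxb : ∀ x ∈ S, ∀ i, (x.1 i : ℕ) + 1 ≤ b i + Fintype.card I := by
    intro x hx i
    have h1 : ∑ j ∈ Finset.univ.erase i, b j ≤ ∑ j ∈ Finset.univ.erase i, ((x.1 j : ℕ) + 1) :=
      Finset.sum_le_sum fun j _ => hbx x hx j
    have h2 := Finset.add_sum_erase Finset.univ b (Finset.mem_univ i)
    have h3 := Finset.add_sum_erase Finset.univ (fun j => (x.1 j : ℕ) + 1) (Finset.mem_univ i)
    have h4 : ∑ j, ((x.1 j : ℕ) + 1) = N + Fintype.card I := by
      rw [Finset.sum_add_distrib, x.2]; simp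
    omega
  refine ⟨S, hSne, ?_, ?_⟩
  · intro x hx y hy i
    have := hxb x hx i
    have := hbx y hy i
    omega
  · intro i
    by_cases hσ : Sum.inr i ∈ σ
    · right
      intro x hx
      have := hxb x hx i
      simp only [b, if_pos hσ] at this
      omega
    · exact Or.inl (hcolS i hσ)

theorem brouwer_approx {I : Type*} [Fintype I] [DecidableEq I] [Nonempty I]
    (f : (I → ℝ) → (I → ℝ)) (hf : ∀ x ∈ stdSimplex ℝ I, f x ∈ stdSimplex ℝ I)
    (N : ℕ) (hN : 0 < N) :
    ∃ x ∈ stdSimplex ℝ I, ∀ i, ∃ x' ∈ stdSimplex ℝ I,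
      dist x' x ≤ (Fintype.card I : ℝ) / N ∧ x' i ≤ f x' i + (Fintype.card I : ℝ) / N := by
  have hN' : (0 : ℝ) < N := by exact_mod_cast hN
  let P : ScGrid I N → (I → ℝ) := fun x i => ((x.1 i : ℕ) : ℝ) / N
  have hP : ∀ x, P x ∈ stdSimplex ℝ I := by
    intro x
    refine ⟨fun i => by positivity, ?_⟩
    simp only [P]
    rw [← Finset.sum_div, ← Nat.cast_sum, x.2, div_self hN'.ne']
  have hcex : ∀ x : ScGrid I N, ∃ i, P x i ≤ f (P x) i := by
    intro x
    by_contra hcon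
    push Not at hcon
    have := Finset.sum_lt_sum_of_nonempty (s := (Finset.univ : Finset I)) Finset.univ_nonempty
      (fun i _ => hcon i)
    rw [(hf _ (hP x)).2, (hP x).2] at this
    exact lt_irrefl _ this
  choose c hc using hcex
  obtain ⟨S, ⟨x0, hx0⟩, hclose, hcol⟩ := scGrid_comb N c
  refine ⟨P x0, hP x0, fun i => ?_⟩
  have hn0 : (0 : ℝ) ≤ (Fintype.card I : ℝ) / N := by positivity
  rcases hcol i with ⟨x, hx, rfl⟩ | h
  · refine ⟨P x, hP x, ?_, (hc x).trans (by linarith)⟩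
    rw [dist_pi_le_iff hn0]
    intro j
    have h1 : ((x.1 j : ℕ) : ℝ) ≤ (x0.1 j : ℕ) + Fintype.card I := by
      exact_mod_cast hclose x hx x0 hx0 j
    have h2 : ((x0.1 j : ℕ) : ℝ) ≤ (x.1 j : ℕ) + Fintype.card I := by
      exact_mod_cast hclose x0 hx0 x hx j
    simp only [P]
    rw [Real.dist_eq, ← sub_div, abs_div, abs_of_pos hN']
    gcongr
    rw [abs_le]
    constructor <;> linarith
  · refine ⟨P x0, hP x0, by rwa [dist_self], ?_⟩
    have h1 : ((x0.1 i : ℕ) : ℝ) ≤ Fintype.card I := by exact_mod_cast h x0 hx0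
    have h2 := (hf _ (hP x0)).1 i
    have : P x0 i ≤ (Fintype.card I : ℝ) / N := by
      simp only [P]; gcongr
    linarith

/-- Brouwer's fixed point theorem on the standard simplex. -/
theorem brouwer_simplex {I : Type*} [Fintype I] [Nonempty I]
    (f : (I → ℝ) → (I → ℝ)) (hf : ∀ x ∈ stdSimplex ℝ I, f x ∈ stdSimplex ℝ I)
    (hfc : ContinuousOn f (stdSimplex ℝ I)) : ∃ x ∈ stdSimplex ℝ I, f x = x := by
  classical
  choose x hx x' hx' hdist hle using fun N : ℕ => brouwer_approx f hf (N + 1) N.succ_pos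
  obtain ⟨z, hz, φ, hφ, hlim⟩ := (isCompact_stdSimplex ℝ I).tendsto_subseq hx
  have hsmall : Tendsto (fun N : ℕ => (Fintype.card I : ℝ) / ((N + 1 : ℕ) : ℝ)) atTop (𝓝 0) :=
    (tendsto_const_div_atTop_nhds_zero_nat _).comp (tendsto_add_atTop_nat 1)
  have hsmall' := hsmall.comp hφ.tendsto_atTop
  have hzle : ∀ i, z i ≤ f z i := by
    intro i
    have h1 : Tendsto (fun k => x' (φ k) i) atTop (𝓝 z) := by
      apply (tendsto_iff_of_dist (f₁ := x ∘ φ) _).1 hlim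
      refine squeeze_zero (fun _ => dist_nonneg) (fun k => ?_) hsmall'
      rw [dist_comm]
      exact hdist (φ k) i
    have h2 : Tendsto (fun k => f (x' (φ k) i)) atTop (𝓝 (f z)) := by
      apply (hfc z hz).tendsto.comp
      exact tendsto_nhdsWithin_iff.2 ⟨h1, Eventually.of_forall fun k => hx' _ _⟩
    have h3 := ((continuous_apply i).tendsto _).comp h1
    have h4 := (((continuous_apply i).tendsto _).comp h2).add hsmall'
    rw [add_zero] at h4
    exact le_of_tendsto_of_tendsto' h3 h4 fun k => hle (φ k) i
  refine ⟨z, hz, ?_⟩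
  have hsum : ∑ i, z i = ∑ i, f z i := by rw [hz.2, (hf z hz).2]
  funext i
  exact (((Finset.sum_eq_sum_iff_of_le fun i _ => hzle i).1 hsum) i (Finset.mem_univ i)).symm

section lassonde
variable {V : Type*} [NormedAddCommGroup V] [NormedSpace ℝ V]

theorem exists_weights (C : Set V) (hC : IsCompact C) (hne : C.Nonempty) (δ : ℝ) (hδ : 0 < δ) :
    ∃ (T : Finset V) (lam : V → V → ℝ), (T : Set V) ⊆ C ∧ T.Nonempty ∧
      (∀ t, Continuous (lam t)) ∧ (∀ t x, 0 ≤ lam t x) ∧ (∀ x, ∑ t ∈ T, lam t x = 1) ∧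
      ∀ x ∈ C, ∀ t ∈ T, lam t x ≠ 0 → dist t x < δ := by
  obtain ⟨T', hT'C, hT'f, hcov⟩ := hC.finite_cover_balls hδ
  obtain ⟨T, rfl⟩ := hT'f.exists_finset_coe
  have hcov' : ∀ x ∈ C, ∃ t ∈ T, dist x t < δ := by
    intro x hx
    have := hcov hx
    simpa using this
  have hTne : T.Nonempty := by
    obtain ⟨x, hx⟩ := hne
    obtain ⟨t, ht, -⟩ := hcov' x hx
    exact ⟨t, ht⟩
  let a : V → V → ℝ := fun t x => max 0 (δ - dist x t) + Metric.infDist x C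
  have ha0 : ∀ t x, 0 ≤ a t x := fun t x =>
    add_nonneg (le_max_left _ _) Metric.infDist_nonneg
  have hac : ∀ t, Continuous (a t) := fun t =>
    (continuous_const.max (continuous_const.sub (continuous_id.dist continuous_const))).add
      (Metric.continuous_infDist_pt C)
  have hpos : ∀ x, 0 < ∑ t ∈ T, a t x := by
    intro x
    by_cases hx : x ∈ C
    · obtain ⟨t, ht, hd⟩ := hcov' x hx
      apply Finset.sum_pos' (fun t _ => ha0 t x) ⟨t, ht, ?_⟩
      exact add_pos_of_pos_of_nonneg (lt_max_of_lt_right (by linarith)) Metric.infDist_nonneg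
    · obtain ⟨t, ht⟩ := hTne
      apply Finset.sum_pos' (fun t _ => ha0 t x) ⟨t, ht, ?_⟩
      exact add_pos_of_nonneg_of_pos (le_max_left _ _)
        ((hC.isClosed.notMem_iff_infDist_pos hne).1 hx)
  refine ⟨T, fun t x => a t x / ∑ t ∈ T, a t x, hT'C, hTne, ?_, ?_, ?_, ?_⟩
  · intro t
    exact (hac t).div (continuous_finsetSum _ fun t _ => hac t) fun x => (hpos x).ne'
  · intro t x
    exact div_nonneg (ha0 t x) (hpos x).le
  · intro x
    rw [← Finset.sum_div, div_self (hpos x).ne']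
  · intro x hx t ht hne0
    by_contra hd
    apply hne0
    have : a t x = 0 := by
      simp only [a]
      rw [Metric.infDist_zero_of_mem hx, max_eq_left, add_zero]
      rw [dist_comm]; linarith
    simp only [this, zero_div]

theorem sum_mem_of_weights {T : Finset V} {l : V → ℝ} {F : V → V} {S : Set V} (hS : Convex ℝ S)
    (h0 : ∀ t, 0 ≤ l t) (h1 : ∑ t ∈ T, l t = 1) (hF : ∀ t ∈ T, l t ≠ 0 → F t ∈ S) :
    ∑ t ∈ T, l t • F t ∈ S := by
  classical
  have e1 : ∑ t ∈ T with l t ≠ 0, l t = 1 := by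
    rw [Finset.sum_filter_ne_zero, h1]
  have e2 : ∑ t ∈ T with l t ≠ 0, l t • F t = ∑ t ∈ T, l t • F t := by
    apply Finset.sum_filter_of_ne
    intro t _ h hl
    exact h (by rw [hl, zero_smul])
  rw [← e2]
  apply hS.sum_mem (fun t _ => h0 t) e1
  intro t ht
  rw [Finset.mem_filter] at ht
  exact hF t ht.1 ht.2

/-- Limit lemma for approximate selections of an upper semicontinuous map. -/
theorem usc_limit (U : Set V) (G : V → Set V) (u : V) (hcv : Convex ℝ (G u))
    (hcpt : IsCompact (G u))
    (husc : ∀ ε > 0, ∃ δ > 0, ∀ u' ∈ U, dist u' u < δ → G u' ⊆ Metric.thickening ε (G u))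
    (x y : ℕ → V) (δ : ℕ → ℝ) (hx : Tendsto x atTop (𝓝 u)) (hδ : Tendsto δ atTop (𝓝 0))
    (hy : ∀ k, y k ∈ convexHull ℝ (⋃ z ∈ {z ∈ U | dist z (x k) < δ k}, G z)) :
    ∃ v ∈ G u, ∃ φ : ℕ → ℕ, StrictMono φ ∧ Tendsto (y ∘ φ) atTop (𝓝 v) := by
  have hev : ∀ ε > 0, ∀ᶠ k in atTop, y k ∈ Metric.thickening ε (G u) := by
    intro ε hε
    obtain ⟨η, hη, h⟩ := husc ε hε
    have e1 : ∀ᶠ k in atTop, dist (x k) u < η / 2 := (tendsto_iff_dist_tendsto_zero.1 hx).eventually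
      (gt_mem_nhds (by linarith))
    have e2 : ∀ᶠ k in atTop, δ k < η / 2 := hδ.eventually (gt_mem_nhds (by linarith))
    filter_upwards [e1, e2] with k h1 h2
    refine convexHull_min ?_ (hcv.thickening ε) (hy k)
    refine Set.iUnion₂_subset fun z hz => h z hz.1 ?_
    have := dist_triangle z (x k) u
    have := hz.2
    linarith
  have hne : (G u).Nonempty := by
    obtain ⟨k, hk⟩ := (hev 1 one_pos).exists
    obtain ⟨z, hz, -⟩ := Metric.mem_thickening_iff.1 hk
    exact ⟨z, hz⟩
  choose z hz hzd using fun k => hcpt.exists_infDist_eq_dist hne (y k)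
  have hd0 : Tendsto (fun k => dist (z k) (y k)) atTop (𝓝 0) := by
    rw [Metric.tendsto_atTop']
    intro ε hε
    obtain ⟨n, hn⟩ := eventually_atTop.1 (hev ε hε)
    refine ⟨n, fun k hk => ?_⟩
    obtain ⟨t, ht, htd⟩ := Metric.mem_thickening_iff.1 (hn k hk.le)
    rw [Real.dist_0_eq_abs, abs_of_nonneg dist_nonneg, dist_comm, ← hzd k]
    exact (Metric.infDist_le_dist_of_mem ht).trans_lt htd
  obtain ⟨v, hv, φ, hφ, hlim⟩ := hcpt.tendsto_subseq hz
  exact ⟨v, hv, φ, hφ, (tendsto_iff_of_dist (hd0.comp hφ.tendsto_atTop)).1 hlim⟩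

theorem tendsto_inv_succ : Tendsto (fun k : ℕ => 1 / ((k : ℝ) + 1)) atTop (𝓝 0) :=
  tendsto_one_div_add_atTop_nhds_zero_nat

/-- Fixed points of `π ∘ G₁ ∘ G₀`, with `π` a continuous map into a polytope. -/
theorem inner_fixed (U₀ U₁ : Set V) (h0cv : Convex ℝ U₀) (h1cv : Convex ℝ U₁)
    (G₀ G₁ : V → Set V)
    (h0usc : ∀ u ∈ U₀, ∀ ε > 0, ∃ δ > 0, ∀ u' ∈ U₀, dist u' u < δ →
      G₀ u' ⊆ Metric.thickening ε (G₀ u))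
    (h0ne : ∀ u ∈ U₀, (G₀ u).Nonempty) (h0cvv : ∀ u ∈ U₀, Convex ℝ (G₀ u))
    (h0cpt : ∀ u ∈ U₀, IsCompact (G₀ u)) (h0m : ∀ u ∈ U₀, G₀ u ⊆ U₁)
    (h1usc : ∀ u ∈ U₁, ∀ ε > 0, ∃ δ > 0, ∀ u' ∈ U₁, dist u' u < δ →
      G₁ u' ⊆ Metric.thickening ε (G₁ u))
    (h1ne : ∀ u ∈ U₁, (G₁ u).Nonempty) (h1cvv : ∀ u ∈ U₁, Convex ℝ (G₁ u))
    (h1cpt : ∀ u ∈ U₁, IsCompact (G₁ u))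
    (T : Finset V) (hT : (T : Set V) ⊆ U₀) (hTne : T.Nonempty) (lam : V → V → ℝ)
    (hlc : ∀ t, Continuous (lam t)) (hl0 : ∀ t x, 0 ≤ lam t x)
    (hl1 : ∀ x, ∑ t ∈ T, lam t x = 1) :
    ∃ u ∈ U₀, ∃ v ∈ G₀ u, ∃ w ∈ G₁ v, ∑ t ∈ T, lam t w • t = u := by
  classical
  let P : Set V := convexHull ℝ (T : Set V)
  have hPU : P ⊆ U₀ := convexHull_min hT h0cv
  have hPc : IsCompact P := T.finite_toSet.isCompact_convexHull ℝ
  have hPne : P.Nonempty := by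
    obtain ⟨t, ht⟩ := hTne
    exact ⟨t, subset_convexHull ℝ _ ht⟩
  have step : ∀ k : ℕ, ∃ u ∈ P, ∃ y ∈ U₁, ∃ w,
      y ∈ convexHull ℝ (⋃ z ∈ {z ∈ U₀ | dist z u < 1 / ((k : ℝ) + 1)}, G₀ z) ∧
      w ∈ convexHull ℝ (⋃ z ∈ {z ∈ U₁ | dist z y < 1 / ((k : ℝ) + 1)}, G₁ z) ∧
      ∑ t ∈ T, lam t w • t = u := by
    intro k
    have hδ : (0 : ℝ) < 1 / ((k : ℝ) + 1) := by positivity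
    obtain ⟨A, α, hAP, hAne, hαc, hα0, hα1, hαd⟩ := exists_weights P hPc hPne _ hδ
    have hF0 : ∀ z, ∃ v, z ∈ U₀ → v ∈ G₀ z := fun z => by
      by_cases hz : z ∈ U₀
      · obtain ⟨v, hv⟩ := h0ne z hz
        exact ⟨v, fun _ => hv⟩
      · exact ⟨0, fun h => absurd h hz⟩
    have hF1 : ∀ z, ∃ v, z ∈ U₁ → v ∈ G₁ z := fun z => by
      by_cases hz : z ∈ U₁
      · obtain ⟨v, hv⟩ := h1ne z hz
        exact ⟨v, fun _ => hv⟩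
      · exact ⟨0, fun h => absurd h hz⟩
    choose F0 hF0 using hF0
    choose F1 hF1 using hF1
    let f : V → V := fun x => ∑ t ∈ A, α t x • F0 t
    have hfc : Continuous f := continuous_finsetSum _ fun t _ => (hαc t).smul continuous_const
    have hfU : ∀ x, f x ∈ U₁ := fun x =>
      sum_mem_of_weights h1cv (fun t => hα0 t x) (hα1 x) fun t ht _ =>
        h0m t (hPU (hAP ht)) (hF0 t (hPU (hAP ht)))
    have hQc : IsCompact (f '' P) := hPc.image hfc
    obtain ⟨B, β, hBQ, hBne, hβc, hβ0, hβ1, hβd⟩ := exists_weights _ hQc (hPne.image f) _ hδ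
    have hBU : ∀ t ∈ B, t ∈ U₁ := by
      intro t ht
      obtain ⟨x, -, rfl⟩ := hBQ ht
      exact hfU x
    let g : V → V := fun x => ∑ t ∈ B, β t x • F1 t
    have hgc : Continuous g := continuous_finsetSum _ fun t _ => (hβc t).smul continuous_const
    have : Nonempty T := hTne.to_subtype
    let L : (T → ℝ) → V := fun c => ∑ t : T, c t • (t : V)
    have hLc : Continuous L := continuous_finsetSum _ fun t _ =>
      (continuous_apply t).smul continuous_const
    have hLP : ∀ c ∈ stdSimplex ℝ T, L c ∈ P := fun c hc =>
      (convex_convexHull ℝ _).sum_mem (fun t _ => hc.1 t) hc.2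
        fun t _ => subset_convexHull ℝ _ t.2
    obtain ⟨c, hc, hfix⟩ := brouwer_simplex (I := T)
      (fun c t => lam t (g (f (L c))))
      (fun c _ => ⟨fun t => hl0 _ _, by
        rw [Finset.sum_coe_sort T (fun t => lam t (g (f (L c))))]; exact hl1 _⟩)
      (Continuous.continuousOn (continuous_pi fun t =>
        (hlc t).comp (hgc.comp (hfc.comp hLc))))
    refine ⟨L c, hLP c hc, f (L c), hfU _, g (f (L c)), ?_, ?_, ?_⟩
    · refine sum_mem_of_weights (convex_convexHull ℝ _) (fun t => hα0 t _) (hα1 _) ?_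
      intro t ht hne
      apply subset_convexHull
      exact Set.mem_biUnion (x := t) ⟨hPU (hAP ht), hαd _ (hLP c hc) t ht hne⟩
        (hF0 t (hPU (hAP ht)))
    · refine sum_mem_of_weights (convex_convexHull ℝ _) (fun t => hβ0 t _) (hβ1 _) ?_
      intro t ht hne
      apply subset_convexHull
      exact Set.mem_biUnion (x := t)
        ⟨hBU t ht, hβd _ (Set.mem_image_of_mem f (hLP c hc)) t ht hne⟩ (hF1 t (hBU t ht))
    · have : L c = ∑ t : T, lam t (g (f (L c))) • (t : V) := by
        conv_lhs => rw [← hfix]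
      rw [Finset.sum_coe_sort T (fun t => lam t (g (f (L c))) • t)] at this
      exact this.symm
  choose u huP y hyU w hy hw hfix using step
  obtain ⟨u', hu', φ, hφ, hlim⟩ := hPc.tendsto_subseq huP
  have hu'U := hPU hu'
  obtain ⟨v, hv, ψ, hψ, hvlim⟩ := usc_limit U₀ G₀ u' (h0cvv _ hu'U) (h0cpt _ hu'U)
    (h0usc _ hu'U) (u ∘ φ) (y ∘ φ) _ hlim (tendsto_inv_succ.comp hφ.tendsto_atTop)
    (fun k => hy (φ k))
  have hvU := h0m _ hu'U hv
  obtain ⟨w', hw', χ, hχ, hwlim⟩ := usc_limit U₁ G₁ v (h1cvv _ hvU) (h1cpt _ hvU)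
    (h1usc _ hvU) ((y ∘ φ) ∘ ψ) ((w ∘ φ) ∘ ψ) _ hvlim
    ((tendsto_inv_succ.comp hφ.tendsto_atTop).comp hψ.tendsto_atTop)
    (fun k => hw (φ (ψ k)))
  refine ⟨u', hu'U, v, hv, w', hw', ?_⟩
  have hpc : Continuous fun x => ∑ t ∈ T, lam t x • t :=
    continuous_finsetSum _ fun t _ => (hlc t).smul continuous_const
  have l1 := (hpc.tendsto w').comp hwlim
  have l2 := (hlim.comp hψ.tendsto_atTop).comp hχ.tendsto_atTop
  refine tendsto_nhds_unique l1 (l2.congr fun k => ?_)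
  exact (hfix _).symm

theorem lassonde_core (U₀ U₁ : Set V) (h0cv : Convex ℝ U₀) (h1cv : Convex ℝ U₁)
    (G₀ G₁ : V → Set V)
    (h0usc : ∀ u ∈ U₀, ∀ ε > 0, ∃ δ > 0, ∀ u' ∈ U₀, dist u' u < δ →
      G₀ u' ⊆ Metric.thickening ε (G₀ u))
    (h0ne : ∀ u ∈ U₀, (G₀ u).Nonempty) (h0cvv : ∀ u ∈ U₀, Convex ℝ (G₀ u))
    (h0cpt : ∀ u ∈ U₀, IsCompact (G₀ u)) (h0m : ∀ u ∈ U₀, G₀ u ⊆ U₁)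
    (h1usc : ∀ u ∈ U₁, ∀ ε > 0, ∃ δ > 0, ∀ u' ∈ U₁, dist u' u < δ →
      G₁ u' ⊆ Metric.thickening ε (G₁ u))
    (h1ne : ∀ u ∈ U₁, (G₁ u).Nonempty) (h1cvv : ∀ u ∈ U₁, Convex ℝ (G₁ u))
    (h1cpt : ∀ u ∈ U₁, IsCompact (G₁ u))
    (K : Set V) (hK : IsCompact K) (hKne : K.Nonempty) (hKU : K ⊆ U₀)
    (hGK : ∀ u ∈ U₀, ∀ v ∈ G₀ u, G₁ v ⊆ K) :
    ∃ u ∈ U₀, ∃ v ∈ G₀ u, u ∈ G₁ v := by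
  have step : ∀ k : ℕ, ∃ u ∈ U₀, ∃ v ∈ G₀ u, ∃ w ∈ G₁ v, dist u w < 1 / ((k : ℝ) + 1) := by
    intro k
    have hδ : (0 : ℝ) < 1 / ((k : ℝ) + 1) := by positivity
    obtain ⟨T, lam, hTK, hTne, hlc, hl0, hl1, hld⟩ := exists_weights K hK hKne _ hδ
    obtain ⟨u, hu, v, hv, w, hw, hfix⟩ := inner_fixed U₀ U₁ h0cv h1cv G₀ G₁ h0usc h0ne h0cvv
      h0cpt h0m h1usc h1ne h1cvv h1cpt T (hTK.trans hKU) hTne lam hlc hl0 hl1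
    refine ⟨u, hu, v, hv, w, hw, ?_⟩
    rw [← hfix]
    have := sum_mem_of_weights (F := fun t => t) (convex_ball w (1 / ((k : ℝ) + 1)))
      (fun t => hl0 t w) (hl1 w) (fun t ht hne => hld w (hGK u hu v hv hw) t ht hne)
    exact this
  choose u hu v hv w hw hd using step
  obtain ⟨z, hz, φ, hφ, hlim⟩ := hK.tendsto_subseq fun k => hGK _ (hu k) _ (hv k) (hw k)
  have hzU := hKU hz
  have hinv := tendsto_inv_succ.comp hφ.tendsto_atTop
  have hulim : Tendsto (u ∘ φ) atTop (𝓝 z) := by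
    refine (tendsto_iff_of_dist (f₁ := w ∘ φ) ?_).1 hlim
    refine squeeze_zero (fun _ => dist_nonneg) (fun k => ?_) hinv
    rw [dist_comm]
    exact (hd (φ k)).le
  obtain ⟨v', hv', ψ, hψ, hvlim⟩ := usc_limit U₀ G₀ z (h0cvv _ hzU) (h0cpt _ hzU)
    (h0usc _ hzU) (u ∘ φ) (v ∘ φ) _ hulim hinv
    (fun k => subset_convexHull ℝ _ (Set.mem_biUnion (x := u (φ k))
      ⟨hu _, by rw [Function.comp_apply, dist_self]; simp only [Function.comp_apply]; positivity⟩
      (hv _)))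
  have hv'U := h0m _ hzU hv'
  obtain ⟨w', hw', χ, hχ, hwlim⟩ := usc_limit U₁ G₁ v' (h1cvv _ hv'U) (h1cpt _ hv'U)
    (h1usc _ hv'U) ((v ∘ φ) ∘ ψ) ((w ∘ φ) ∘ ψ) _ hvlim (hinv.comp hψ.tendsto_atTop)
    (fun k => subset_convexHull ℝ _ (Set.mem_biUnion (x := v (φ (ψ k)))
      ⟨h0m _ (hu _) (hv _), by
        simp only [Function.comp_apply, dist_self]; positivity⟩
      (hw _)))
  have : w' = z := tendsto_nhds_unique hwlim
    ((hlim.comp hψ.tendsto_atTop).comp hχ.tendsto_atTop)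
  exact ⟨z, hzU, v', hv', this ▸ hw'⟩

/-- Extension of a set-valued map between subtypes to the ambient space. -/
def extMap {A B : Set V} (Γ : ↥A → Set ↥B) (u : V) : Set V :=
  {v | ∃ hu : u ∈ A, v ∈ ((↑) '' Γ ⟨u, hu⟩ : Set V)}

theorem extMap_eq {A B : Set V} (Γ : ↥A → Set ↥B) (u : V) (hu : u ∈ A) :
    extMap Γ u = ((↑) '' Γ ⟨u, hu⟩ : Set V) := by
  ext v
  exact ⟨fun ⟨_, h⟩ => h, fun h => ⟨hu, h⟩⟩

theorem extMap_usc {A B : Set V} (Γ : ↥A → Set ↥B)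
    (h : ∀ u : ↥A, ∀ W : Set ↥B, IsOpen W → Γ u ⊆ W → ∀ᶠ u' in 𝓝 u, Γ u' ⊆ W) :
    ∀ u ∈ A, ∀ ε > 0, ∃ δ > 0, ∀ u' ∈ A, dist u' u < δ →
      extMap Γ u' ⊆ Metric.thickening ε (extMap Γ u) := by
  intro u hu ε hε
  have hop : IsOpen ((fun b : ↥B => (b : V)) ⁻¹' Metric.thickening ε (extMap Γ u)) :=
    Metric.isOpen_thickening.preimage continuous_subtype_val
  have hsub : Γ ⟨u, hu⟩ ⊆ (fun b : ↥B => (b : V)) ⁻¹' Metric.thickening ε (extMap Γ u) := by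
    intro v hv
    have hv' : (v : V) ∈ extMap Γ u := ⟨hu, v, hv, rfl⟩
    exact Metric.self_subset_thickening hε _ hv'
  have h1 := h ⟨u, hu⟩ _ hop hsub
  obtain ⟨δ, hδ, hb⟩ := Metric.eventually_nhds_iff.1 h1
  refine ⟨δ, hδ, fun u' hu' hd => ?_⟩
  rintro _ ⟨_, v, hv, rfl⟩
  have hd' : dist (⟨u', hu'⟩ : ↥A) ⟨u, hu⟩ < δ := hd
  have h2 := hb hd'
  exact h2 hv

end lassonde

/-- Lassonde's fixed point theorem for Kakutani factorizable maps, two-factor case. -/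
theorem stmt7 {V : Type*} [NormedAddCommGroup V] [NormedSpace ℝ V]
    (U₀ U₁ : Set V) (h0ne : U₀.Nonempty) (h1ne : U₁.Nonempty)
    (h0cv : Convex ℝ U₀) (h1cv : Convex ℝ U₁)
    (Γ₀ : ↥U₀ → Set ↥U₁) (Γ₁ : ↥U₁ → Set ↥U₀)
    (h0usc : ∀ u : ↥U₀, ∀ W : Set ↥U₁, IsOpen W → Γ₀ u ⊆ W → ∀ᶠ u' in 𝓝 u, Γ₀ u' ⊆ W)
    (h0nev : ∀ u, (Γ₀ u).Nonempty)
    (h0cvv : ∀ u, Convex ℝ (((↑) '' Γ₀ u : Set V)))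
    (h0cpt : ∀ u, IsCompact (Γ₀ u))
    (h1usc : ∀ v : ↥U₁, ∀ W : Set ↥U₀, IsOpen W → Γ₁ v ⊆ W → ∀ᶠ v' in 𝓝 v, Γ₁ v' ⊆ W)
    (h1nev : ∀ v, (Γ₁ v).Nonempty)
    (h1cvv : ∀ v, Convex ℝ (((↑) '' Γ₁ v : Set V)))
    (h1cpt : ∀ v, IsCompact (Γ₁ v))
    (hcl : IsCompact (closure (⋃ u : ↥U₀, ⋃ v ∈ Γ₀ u, Γ₁ v))) :
    ∃ u : ↥U₀, u ∈ ⋃ v ∈ Γ₀ u, Γ₁ v := by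
  obtain ⟨u, hu, v, hv, huv⟩ := lassonde_core U₀ U₁ h0cv h1cv (extMap Γ₀) (extMap Γ₁)
    (extMap_usc Γ₀ h0usc)
    (fun u hu => by rw [extMap_eq Γ₀ u hu]; exact (h0nev _).image _)
    (fun u hu => by rw [extMap_eq Γ₀ u hu]; exact h0cvv _)
    (fun u hu => by rw [extMap_eq Γ₀ u hu]; exact (h0cpt _).image continuous_subtype_val)
    (fun u hu => by rw [extMap_eq Γ₀ u hu]; rintro _ ⟨v, -, rfl⟩; exact v.2)
    (extMap_usc Γ₁ h1usc)
    (fun u hu => by rw [extMap_eq Γ₁ u hu]; exact (h1nev _).image _)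
    (fun u hu => by rw [extMap_eq Γ₁ u hu]; exact h1cvv _)
    (fun u hu => by rw [extMap_eq Γ₁ u hu]; exact (h1cpt _).image continuous_subtype_val)
    ((↑) '' closure (⋃ u : ↥U₀, ⋃ v ∈ Γ₀ u, Γ₁ v)) (hcl.image continuous_subtype_val)
    (by
      obtain ⟨u, hu⟩ := h0ne
      obtain ⟨v, hv⟩ := h0nev ⟨u, hu⟩
      obtain ⟨w, hw⟩ := h1nev v
      exact ⟨w, w, subset_closure (Set.mem_iUnion.2 ⟨_, Set.mem_biUnion hv hw⟩), rfl⟩)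
    (by rintro _ ⟨x, -, rfl⟩; exact x.2)
    (by
      rintro u hu v ⟨_, v', hv', rfl⟩ w ⟨_, w', hw', rfl⟩
      exact ⟨w', subset_closure (Set.mem_iUnion.2 ⟨_, Set.mem_biUnion hv' hw'⟩), rfl⟩)
  obtain ⟨_, v', hv', rfl⟩ := hv
  obtain ⟨_, u', hu', rfl⟩ := huv
  exact ⟨u', Set.mem_biUnion hv' hu'⟩
end

section
/- Let V be a normed space with norm p, U ⊆ V nonempty, convex, and approximatively compact, f : V → ℝ continuous and quasi-concave, and K : U → 2^V a continuous set-valued map with nonempty, closed, convex values such that the closure of K(U) is compact. Then the quasi-optimization problem QuOp(K,f) admits a best approximate solution: there exist ū ∈ U and v̄ ∈ V with p(v̄ - ū) = inf_{u ∈ U} p(v̄ - u) and f(v̄) = max_{w ∈ K(ū)} f(w). -/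
open Filter Topology Set

/-- Dominance. -/
def ScarfDom {X I : Type*} (r : I → X → ℕ) (S : Finset X) : Prop :=
  ∀ y, ∃ i, ∀ x ∈ S, r i y ≤ r i x

theorem ScarfDom.mono {X I : Type*} {r : I → X → ℕ} {S T : Finset X} (h : ScarfDom r S)
    (hTS : T ⊆ S) : ScarfDom r T := fun y => by
  obtain ⟨i, hi⟩ := h y
  exact ⟨i, fun x hx => hi x (hTS hx)⟩

/-- `x` is the `d`-largest point beyond the other walls. -/
def ScarfMx {X I : Type*} (r : I → X → ℕ) (m : I → X) (d : I) (x : X) : Prop :=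
  (∀ i, i ≠ d → r i (m i) < r i x) ∧ ∀ y, (∀ i, i ≠ d → r i (m i) < r i y) → r d y ≤ r d x

theorem scarf_mx_exists {X I : Type*} [Fintype X] (r : I → X → ℕ) (m : I → X) (d : I) (z : X)
    (hz : ∀ i, i ≠ d → r i (m i) < r i z) : ∃ x, ScarfMx r m d x := by
  classical
  obtain ⟨x, hx, hx'⟩ := Finset.exists_max_image
    (Finset.univ.filter fun y => ∀ i, i ≠ d → r i (m i) < r i y) (r d) ⟨z, by simpa using hz⟩
  refine ⟨x, by simpa using hx, fun y hy => hx' y (by simpa using hy)⟩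

theorem scarf_door {X I : Type*} [DecidableEq X] [Fintype I] [DecidableEq I]
    (r : I → X → ℕ) (hr : ∀ i, Function.Injective (r i)) (τ : Finset X) (hne : τ.Nonempty)
    (hcard : τ.card + 1 = Fintype.card I) (hD : ScarfDom r τ) :
    ∃ (m : I → X) (j k : I), j ≠ k ∧ (∀ i, m i ∈ τ ∧ ∀ x ∈ τ, r i (m i) ≤ r i x) ∧ m j = m k ∧
      (∀ d, (∀ x ∈ τ, ∃ i, i ≠ d ∧ m i = x) → d = j ∨ d = k) ∧
      (∀ x, (x ∉ τ ∧ ScarfDom r (insert x τ)) ↔ ScarfMx r m j x ∨ ScarfMx r m k x) ∧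
      (∀ x, ScarfMx r m j x → ScarfMx r m k x → False) := by
  have hm : ∀ i, ∃ x, x ∈ τ ∧ ∀ y ∈ τ, r i x ≤ r i y := fun i => by
    obtain ⟨x, hx, h⟩ := Finset.exists_min_image τ (r i) hne
    exact ⟨x, hx, h⟩
  choose m hm using hm
  have hmeq : ∀ i x, x ∈ τ → (∀ y ∈ τ, r i x ≤ r i y) → m i = x := fun i x hx h =>
    hr i (le_antisymm ((hm i).2 x hx) (h _ (hm i).1))
  obtain ⟨j, -, k, -, hjk, hmjk⟩ := Finset.exists_ne_map_eq_of_card_lt_of_maps_to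
    (s := (Finset.univ : Finset I)) (t := τ) (f := m) (by rw [Finset.card_univ]; omega)
    (fun i _ => (hm i).1)
  have hpig : ∀ d e, d ≠ e → ∃ z ∈ τ, ∀ i, i ≠ d → i ≠ e → m i ≠ z := by
    intro d e hde
    by_contra! hcon
    have hsub : τ ⊆ ((Finset.univ.erase d).erase e).image m := by
      intro z hz
      obtain ⟨i, h1, h2, h3⟩ := hcon z hz
      exact Finset.mem_image.2 ⟨i, by simp [h1, h2], h3⟩
    have h1 := Finset.card_le_card hsub
    have h2 := Finset.card_image_le (s := (Finset.univ.erase d).erase e) (f := m)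
    rw [Finset.card_erase_of_mem (by simp [hde.symm]), Finset.card_erase_of_mem (by simp),
      Finset.card_univ] at h2
    have : 0 < τ.card := hne.card_pos
    omega
  have hC : ∀ d, (∀ x ∈ τ, ∃ i, i ≠ d ∧ m i = x) → d = j ∨ d = k := by
    intro d hd
    by_contra! hcon
    obtain ⟨z, hz, hz'⟩ := hpig d j hcon.1
    obtain ⟨i, hi, hiz⟩ := hd z hz
    by_cases hij : i = j
    · exact hz' k hcon.2.symm hjk.symm (by rw [← hmjk, ← hij, hiz])
    · exact hz' i hi hij hiz
  have hback : ∀ d e, d ≠ e → m d = m e → ∀ x, ScarfMx r m d x →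
      x ∉ τ ∧ ScarfDom r (insert x τ) := by
    intro d e hde hmde x hx
    constructor
    · intro hxτ
      obtain ⟨i, hi⟩ := hD x
      have hid : i = d := by
        by_contra hid
        exact absurd (hx.1 i hid) (not_lt.2 (hi _ (hm i).1))
      subst hid
      have h1 := hmeq i x hxτ hi
      have h2 := hx.1 e hde.symm
      rw [← hmde, h1] at h2
      exact lt_irrefl _ h2
    · intro y
      by_contra! hcon
      have hyM : ∀ i, i ≠ d → r i (m i) < r i y := by
        intro i hi
        obtain ⟨z, hz, hzy⟩ := hcon i
        rcases Finset.mem_insert.1 hz with rfl | hz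
        · exact (hx.1 i hi).trans hzy
        · exact ((hm i).2 z hz).trans_lt hzy
      obtain ⟨z, hz, hzy⟩ := hcon d
      rcases Finset.mem_insert.1 hz with rfl | hz
      · exact absurd (hx.2 y hyM) (not_le.2 hzy)
      · obtain ⟨i, hi⟩ := hD y
        by_cases hid : i = d
        · subst hid; exact absurd (hi z hz) (not_le.2 hzy)
        · exact absurd (hi _ (hm i).1) (not_le.2 (hyM i hid))
  refine ⟨m, j, k, hjk, hm, hmjk, hC, fun x => ⟨?_, ?_⟩, ?_⟩
  · rintro ⟨hxτ, hDx⟩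
    obtain ⟨d, hd⟩ := hDx x
    have hne' : ∀ i z, z ∈ τ → (∀ w ∈ insert x τ, r i z ≤ r i w) → 
        m i = z ∧ r i z < r i x := by
      intro i z hz h
      refine ⟨hmeq i z hz fun y hy => h y (Finset.mem_insert_of_mem hy), ?_⟩
      refine lt_of_le_of_ne (h x (Finset.mem_insert_self _ _)) fun he => hxτ ?_
      rw [← hr i he]; exact hz
    have hlt : ∀ i, i ≠ d → r i (m i) < r i x := by
      intro i hi
      by_contra! hcon
      obtain ⟨z, hz, hz'⟩ := hpig d i hi.symm
      obtain ⟨l, hl⟩ := hDx z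
      obtain ⟨h1, h2⟩ := hne' l z hz hl
      refine hz' l ?_ ?_ h1
      · rintro rfl; exact absurd (hd z (Finset.mem_insert_of_mem hz)) (not_le.2 h2)
      · rintro rfl; rw [h1] at hcon; omega
    have hdjk : d = j ∨ d = k := by
      apply hC
      intro z hz
      obtain ⟨l, hl⟩ := hDx z
      obtain ⟨h1, h2⟩ := hne' l z hz hl
      refine ⟨l, ?_, h1⟩
      rintro rfl; exact absurd (hd z (Finset.mem_insert_of_mem hz)) (not_le.2 h2)
    have hMx : ScarfMx r m d x := by
      refine ⟨hlt, fun y hy => ?_⟩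
      obtain ⟨i, hi⟩ := hDx y
      by_cases hid : i = d
      · subst hid; exact hi x (Finset.mem_insert_self _ _)
      · exact absurd (hi _ (Finset.mem_insert_of_mem (hm i).1)) (not_le.2 (hy i hid))
    rcases hdjk with rfl | rfl
    · exact Or.inl hMx
    · exact Or.inr hMx
  · rintro (h | h)
    · exact hback j k hjk hmjk x h
    · exact hback k j hjk.symm hmjk.symm x h
  · intro x h1 h2
    obtain ⟨i, hi⟩ := hD x
    have : r i (m i) < r i x := by
      by_cases hij : i = j
      · subst hij; exact h2.1 i hjk
      · exact h1.1 i hij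
    exact absurd (hi _ (hm i).1) (not_le.2 this)

theorem scarf_abs {X I : Type*} [Fintype X] [DecidableEq X] [Fintype I] [DecidableEq I]
    (r : I → X → ℕ) (hr : ∀ i, Function.Injective (r i)) (c : X → I) (s : I → X)
    (hcs : ∀ i, c (s i) = i) (hmin : ∀ i x, r i (s i) ≤ r i x)
    (htop : ∀ i k x, i ≠ k → (∀ l, x ≠ s l) → r i x < r i (s k))
    (x0 : X) (hx0 : ∀ l, x0 ≠ s l) (i0 : I) :
    ∃ S : Finset X, (∀ i, ∃ x ∈ S, c x = i) ∧ ScarfDom r S := by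
  classical
  by_cases h1 : Fintype.card I = 1
  · have hsub : Subsingleton I := Fintype.card_le_one_iff_subsingleton.1 h1.le
    obtain ⟨x, -, hx⟩ := Finset.exists_max_image Finset.univ (r i0) ⟨x0, Finset.mem_univ _⟩
    refine ⟨{x}, fun i => ⟨x, by simp, Subsingleton.elim _ _⟩, fun y => ⟨i0, fun z hz => ?_⟩⟩
    rw [Finset.mem_singleton.1 hz]; exact hx y (Finset.mem_univ _)
  have hn : 2 ≤ Fintype.card I := by
    have : 0 < Fintype.card I := Fintype.card_pos_iff.2 ⟨i0⟩
    omega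
  by_contra hno
  have hsinj : Function.Injective s := fun a b h => by rw [← hcs a, h, hcs]
  let A : Finset (Finset X) := Finset.univ.filter fun τ =>
    τ.card + 1 = Fintype.card I ∧ τ.image c = Finset.univ.erase i0 ∧ ScarfDom r τ
  let B : Finset (Finset X) := Finset.univ.filter fun σ =>
    σ.card = Fintype.card I ∧ ScarfDom r σ
  have hA : ∀ τ, τ ∈ A ↔ τ.card + 1 = Fintype.card I ∧ τ.image c = Finset.univ.erase i0 ∧
    ScarfDom r τ := fun τ => by simp [A]
  have hB : ∀ τ, τ ∈ B ↔ τ.card = Fintype.card I ∧ ScarfDom r τ := fun τ => by simp [B]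
  have hext : ∀ τ ∈ A, ∀ σ, (σ ∈ B ∧ τ ⊆ σ) ↔ 
      ∃ x, (x ∉ τ ∧ ScarfDom r (insert x τ)) ∧ insert x τ = σ := by
    intro τ hτ σ
    rw [hA] at hτ
    rw [hB]
    constructor
    · rintro ⟨⟨h1, h2⟩, h3⟩
      obtain ⟨x, hx, hx'⟩ := (Finset.covBy_iff_exists_insert (s := τ) (t := σ)).1
        ((Finset.covBy_iff_card_sdiff_eq_one).2 ⟨h3, by
          rw [Finset.card_sdiff_of_subset h3]; omega⟩)
      exact ⟨x, ⟨hx, by rwa [hx']⟩, hx'⟩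
    · rintro ⟨x, ⟨h1, h2⟩, rfl⟩
      exact ⟨⟨by rw [Finset.card_insert_of_notMem h1]; exact hτ.1, h2⟩, Finset.subset_insert _ _⟩
  have hcinj : ∀ τ ∈ A, ∀ x ∈ τ, ∀ y ∈ τ, c x = c y → x = y := by
    intro τ hτ x hx y hy h
    rw [hA] at hτ
    have : (τ.image c).card = τ.card := by
      rw [hτ.2.1, Finset.card_erase_of_mem (Finset.mem_univ _), Finset.card_univ]; omega
    exact Finset.card_image_iff.1 this hx hy h
  have hmem : ∀ τ ∈ A, ∀ l, l ≠ i0 ↔ ∃ x ∈ τ, c x = l := by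
    intro τ hτ l
    rw [hA] at hτ
    rw [← Finset.mem_image, hτ.2.1]; simp
  -- rooms have an even number of doors
  have hroom : ∀ σ ∈ B, Even (A.filter fun τ => τ ⊆ σ).card := by
    intro σ hσ
    rcases (A.filter fun τ => τ ⊆ σ).eq_empty_or_nonempty with he | ⟨τ, hτ⟩
    · rw [he]; simp
    obtain ⟨hτA, hτσ⟩ := Finset.mem_filter.1 hτ
    obtain ⟨x, ⟨hxτ, hxD⟩, rfl⟩ := (hext τ hτA σ).1 ⟨hσ, hτσ⟩
    have hcx : c x ≠ i0 := by
      intro hcx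
      refine hno ⟨_, fun i => ?_, hxD⟩
      by_cases hi : i = i0
      · exact ⟨x, by simp, by rw [hcx, hi]⟩
      · obtain ⟨z, hz, hz'⟩ := (hmem τ hτA i).1 hi
        exact ⟨z, by simp [hz], hz'⟩
    obtain ⟨x', hx', hcx'⟩ := (hmem τ hτA _).1 hcx
    have hxx' : x ≠ x' := by rintro rfl; exact hxτ hx'
    have hτ'A : (insert x τ).erase x' ∈ A := by
      rw [hA]
      refine ⟨?_, ?_, hxD.mono (Finset.erase_subset _ _)⟩
      · rw [Finset.card_erase_of_mem (by simp [hx']), Finset.card_insert_of_notMem hxτ]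
        have := ((hA τ).1 hτA).1
        omega
      · ext l
        simp only [Finset.mem_image, Finset.mem_erase, Finset.mem_insert, Finset.mem_univ, and_true]
        constructor
        · rintro ⟨z, ⟨hz1, rfl | hz2⟩, rfl⟩
          · exact hcx
          · exact (hmem τ hτA _).2 ⟨z, hz2, rfl⟩
        · intro hl
          obtain ⟨z, hz, hz'⟩ := (hmem τ hτA l).1 hl
          by_cases hzx : z = x'
          · exact ⟨x, ⟨hxx', Or.inl rfl⟩, by rw [← hcx', ← hzx, hz']⟩
          · exact ⟨z, ⟨hzx, Or.inr hz⟩, hz'⟩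
    have : (A.filter fun τ' => τ' ⊆ insert x τ) = {τ, (insert x τ).erase x'} := by
      ext τ'
      simp only [Finset.mem_filter, Finset.mem_insert, Finset.mem_singleton]
      constructor
      · rintro ⟨h1, h2⟩
        obtain ⟨z, ⟨hz, -⟩, hz'⟩ := (hext τ' h1 _).1 ⟨hσ, h2⟩
        have hτz : τ' = (insert x τ).erase z := by rw [← hz', Finset.erase_insert hz]
        by_cases hzx : z = x
        · left; rw [hτz, hzx, Finset.erase_insert hxτ]
        by_cases hzx' : z = x'
        · right; rw [hτz, hzx']
        exfalso
        refine hxx' (hcinj τ' h1 x ?_ x' ?_ hcx'.symm)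
        · rw [hτz]; simp [Ne.symm hzx]
        · rw [hτz]; simp [Ne.symm hzx', hx']
      · rintro (rfl | rfl)
        · exact ⟨hτA, hτσ⟩
        · exact ⟨hτ'A, Finset.erase_subset _ _⟩
    rw [this, Finset.card_pair]
    · exact even_two
    · intro h
      have : x' ∈ (insert x τ).erase x' := h ▸ hx'
      simp at this
  -- the outer door
  let τ0 : Finset X := (Finset.univ.erase i0).image s
  have hτ0 : ∀ x, x ∈ τ0 ↔ ∃ l, l ≠ i0 ∧ s l = x := fun x => by simp [τ0]
  have hτ0A : τ0 ∈ A := by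
    rw [hA]
    refine ⟨?_, ?_, fun y => ?_⟩
    · rw [Finset.card_image_of_injective _ hsinj, Finset.card_erase_of_mem (Finset.mem_univ _),
        Finset.card_univ]; omega
    · ext l; simp [τ0, hcs]
    · by_cases hy : ∃ l, y = s l
      · obtain ⟨l, rfl⟩ := hy
        exact ⟨l, fun x _ => hmin l x⟩
      · push Not at hy
        refine ⟨i0, fun x hx => ?_⟩
        obtain ⟨l, hl, rfl⟩ := (hτ0 x).1 hx
        exact (htop i0 l y hl.symm hy).le
  have hdoor0 : (B.filter fun σ => τ0 ⊆ σ).card = 1 := by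
    have hτ0' := (hA τ0).1 hτ0A
    obtain ⟨m, j, k, hjk, hm, hmjk, hC, hMx, -⟩ := scarf_door r hr τ0
      (Finset.card_pos.1 (by omega)) hτ0'.1 hτ0'.2.2
    have hms : ∀ i, i ≠ i0 → m i = s i := fun i hi => hr i
      (le_antisymm ((hm i).2 _ ((hτ0 _).2 ⟨i, hi, rfl⟩)) (hmin _ _))
    have key : ∀ k, k ≠ i0 → m i0 = m k → (∀ x, (x ∉ τ0 ∧ ScarfDom r (insert x τ0)) ↔
        ScarfMx r m i0 x ∨ ScarfMx r m k x) → (B.filter fun σ => τ0 ⊆ σ).card = 1 := by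
      intro k hk hmk hMx
      obtain ⟨x, hx⟩ := scarf_mx_exists r m i0 x0 (fun i hi => by
        rw [hms i hi]
        exact lt_of_le_of_ne (hmin _ _) fun h => hx0 i (hr i h).symm)
      have hempty : ∀ y, ¬ ScarfMx r m k y := by
        intro y hy
        obtain ⟨i, hi⟩ := hτ0'.2.2 y
        have hik : i = k := by
          by_contra hik
          exact absurd (hy.1 i hik) (not_lt.2 (hi _ (hm i).1))
        subst hik
        have h1 := hi _ (hm i).1
        rw [hms i hk] at h1
        have h2 : y = s i := hr i (le_antisymm h1 (hmin _ _))
        have h3 := hy.1 i0 hk.symm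
        rw [hmk, hms i hk, h2] at h3
        exact lt_irrefl _ h3
      rw [Finset.card_eq_one]
      refine ⟨insert x τ0, ?_⟩
      ext σ
      rw [Finset.mem_filter, hext τ0 hτ0A, Finset.mem_singleton]
      constructor
      · rintro ⟨z, hz, rfl⟩
        rw [hMx] at hz
        have hz := hz.resolve_right (hempty z)
        rw [hr i0 (le_antisymm (hz.2 x hx.1) (hx.2 z hz.1))]
      · rintro rfl
        exact ⟨x, (hMx x).2 (Or.inl hx), rfl⟩
    rcases hC i0 (fun x hx => by
      obtain ⟨l, hl, rfl⟩ := (hτ0 x).1 hx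
      exact ⟨l, hl, hms l hl⟩) with h | h
    · exact key k (by rw [h]; exact hjk.symm) (by rw [h]; exact hmjk) (by rw [h]; exact hMx)
    · exact key j (by rw [h]; exact hjk) (by rw [h]; exact hmjk.symm)
        (by intro x; rw [h, hMx x]; exact or_comm)
  have hdoor : ∀ τ ∈ A, τ ≠ τ0 → (B.filter fun σ => τ ⊆ σ).card = 2 := by
    intro τ hτA hne
    have hτ := (hA τ).1 hτA
    obtain ⟨m, j, k, hjk, hm, hmjk, hC, hMx, hex⟩ := scarf_door r hr τ
      (Finset.card_pos.1 (by omega)) hτ.1 hτ.2.2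
    have hms : ∀ i k, k ≠ i → m i ≠ s k := by
      intro i k hki h
      apply hne
      have hsi : s i ∉ τ := by
        intro hsi
        have h1 := (hm i).2 _ hsi
        rw [h] at h1
        exact hki (hsinj (hr i (le_antisymm h1 (hmin _ _))))
      have hsl : ∀ x ∈ τ, ∃ l, x = s l := by
        intro x hx
        by_contra! hcon
        have h1 := (hm i).2 x hx
        rw [h] at h1
        exact absurd (htop i k x hki.symm hcon) (not_lt.2 h1)
      have hii0 : i = i0 := by
        by_contra hi
        obtain ⟨x, hx, hx'⟩ := (hmem τ hτA i).1 hi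
        obtain ⟨l, rfl⟩ := hsl x hx
        rw [hcs] at hx'
        subst hx'
        exact hsi hx
      refine Finset.eq_of_subset_of_card_le (fun x hx => ?_) (by
        have := ((hA τ0).1 hτ0A).1
        omega)
      obtain ⟨l, rfl⟩ := hsl x hx
      refine (hτ0 _).2 ⟨l, ?_, rfl⟩
      rintro rfl
      exact hsi (hii0 ▸ hx)
    have hM : ∀ d, ∃ x, ScarfMx r m d x := by
      intro d
      refine scarf_mx_exists r m d (s d) fun i hi => ?_
      by_cases h : ∃ l, m i = s l
      · obtain ⟨l, hl⟩ := h
        have : l = i := by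
          by_contra hli
          exact hms i l hli hl
        subst this
        rw [hl]
        exact (hmin l x0).trans_lt (htop l d x0 hi hx0)
      · push Not at h
        exact htop i d _ hi h
    obtain ⟨x, hx⟩ := hM j
    obtain ⟨y, hy⟩ := hM k
    have hxy : x ≠ y := by rintro rfl; exact hex x hx hy
    have hx1 := (hMx x).2 (Or.inl hx)
    have hy1 := (hMx y).2 (Or.inr hy)
    rw [Finset.card_eq_two]
    refine ⟨insert x τ, insert y τ, ?_, ?_⟩
    · intro h
      have : x ∈ insert y τ := h ▸ Finset.mem_insert_self _ _
      rcases Finset.mem_insert.1 this with h | h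
      · exact hxy h
      · exact hx1.1 h
    · ext σ
      rw [Finset.mem_filter, hext τ hτA, Finset.mem_insert, Finset.mem_singleton]
      constructor
      · rintro ⟨z, hz, rfl⟩
        rcases (hMx z).1 hz with hz | hz
        · left; rw [hr j (le_antisymm (hz.2 x hx.1) (hx.2 z hz.1))]
        · right; rw [hr k (le_antisymm (hz.2 y hy.1) (hy.2 z hz.1))]
      · rintro (rfl | rfl)
        · exact ⟨x, hx1, rfl⟩
        · exact ⟨y, hy1, rfl⟩
  have hcount := Finset.sum_card_bipartiteAbove_eq_sum_card_bipartiteBelow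
    (s := A) (t := B) (fun τ σ => τ ⊆ σ)
  simp only [Finset.bipartiteAbove, Finset.bipartiteBelow] at hcount
  have h2 : Even (∑ σ ∈ B, (A.filter fun τ => τ ⊆ σ).card) := Finset.even_sum _ hroom
  rw [← hcount, ← Finset.add_sum_erase A _ hτ0A, hdoor0,
    Finset.sum_congr rfl (fun τ hτ => hdoor τ (Finset.mem_of_mem_erase hτ)
      (Finset.ne_of_mem_erase hτ)), Finset.sum_const, smul_eq_mul] at h2
  rcases h2 with ⟨q, hq⟩
  omega

theorem scarf_grid {I : Type*} [Fintype I] [DecidableEq I] (i0 : I) (N : ℕ) (c : (I → ℕ) → I) :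
    ∃ z : I → ℕ, ∑ i, z i = N ∧ ∀ i, Fintype.card I < z i → ∃ u : I → ℕ, ∑ i, u i = N ∧ c u = i ∧
      ∀ l, z l ≤ u l + Fintype.card I ∧ u l ≤ z l + Fintype.card I := by
  classical
  let T := {z : I → ℕ // z ∈ Finset.piAntidiag Finset.univ N}
  have hT : ∀ z : T, ∑ i, z.1 i = N := fun z => (Finset.mem_piAntidiag.1 z.2).1
  have mkT : ∀ z : I → ℕ, ∑ i, z i = N → z ∈ Finset.piAntidiag Finset.univ N := fun z hz =>
    Finset.mem_piAntidiag.2 ⟨hz, fun i _ => Finset.mem_univ i⟩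
  have hTle : ∀ (z : T) i, z.1 i ≤ N := fun z i => by
    exact (Finset.single_le_sum (f := z.1) (fun _ _ => Nat.zero_le _) (Finset.mem_univ i)).trans
      (hT z).le
  have : Fintype T := inferInstanceAs
    (Fintype {z : I → ℕ // z ∈ Finset.piAntidiag Finset.univ N})
  let M := Fintype.card T
  let e : T → ℕ := fun z => (Fintype.equivFin T z : ℕ)
  have he : ∀ z, e z < M := fun z => (Fintype.equivFin T z).2
  have hei : Function.Injective e := fun a b h => (Fintype.equivFin T).injective (Fin.ext h)
  let e' : I → ℕ := fun z => (Fintype.equivFin I z : ℕ)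
  have hei' : Function.Injective e' := fun a b h => (Fintype.equivFin I).injective (Fin.ext h)
  let r : I → T ⊕ I → ℕ := fun i => Sum.elim (fun z => 1 + (z.1 i * M + e z))
    (fun k => if k = i then 0 else 1 + (N + 1) * M + e' k)
  have hrl : ∀ i z, r i (Sum.inl z) = 1 + (z.1 i * M + e z) := fun i z => rfl
  have hrr : ∀ i k, r i (Sum.inr k) = if k = i then 0 else 1 + (N + 1) * M + e' k :=
    fun i k => rfl
  have hlex : ∀ (z w : T) i, r i (Sum.inl z) ≤ r i (Sum.inl w) → z.1 i ≤ w.1 i := by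
    intro z w i h
    rw [hrl, hrl] at h
    by_contra! hlt
    have h1 : (w.1 i + 1) * M ≤ z.1 i * M := Nat.mul_le_mul_right _ hlt
    have h2 := he w
    rw [add_mul] at h1
    omega
  have hbd : ∀ (z : T) i, r i (Sum.inl z) < 1 + (N + 1) * M := by
    intro z i
    rw [hrl]
    have h1 : z.1 i * M ≤ N * M := Nat.mul_le_mul_right _ (hTle z i)
    have h2 := he z
    rw [add_mul]
    omega
  have hrinj : ∀ i, Function.Injective (r i) := by
    intro i x y h
    rcases x with z | k <;> rcases y with w | l
    · have h1 := hlex z w i h.le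
      have h2 := hlex w z i h.ge
      rw [hrl, hrl, le_antisymm h1 h2] at h
      have : e z = e w := by omega
      rw [hei this]
    · have h1 := hbd z i
      rw [hrr] at h
      split_ifs at h
      · rw [hrl] at h; omega
      · omega
    · have h1 := hbd w i
      rw [hrr] at h
      split_ifs at h
      · rw [hrl] at h; omega
      · omega
    · rw [hrr, hrr] at h
      split_ifs at h with h1 h2 h2
      · rw [h1, h2]
      · omega
      · omega
      · have : e' k = e' l := by omega
        rw [hei' this]
  let t0 : T := ⟨Pi.single i0 N, mkT _ (by simp)⟩
  obtain ⟨S, hSc, hSD⟩ := scarf_abs r hrinj (Sum.elim (fun z => c z.1) id) Sum.inr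
    (fun i => rfl) (fun i x => by rw [hrr]; simp)
    (fun i k x hik hx => by
      rcases x with z | l
      · rw [hrr, if_neg hik.symm]
        exact (hbd z i).trans_le (Nat.le_add_right _ _)
      · exact absurd rfl (hx l))
    (Sum.inl t0) (fun l => by simp) i0
  let C : Finset I := Finset.univ.filter fun i => Sum.inr i ∉ S
  have hC : ∀ i, i ∈ C ↔ Sum.inr i ∉ S := fun i => by simp [C]
  have hu : ∀ i ∈ C, ∃ u : T, Sum.inl u ∈ S ∧ c u.1 = i := by
    intro i hi
    obtain ⟨x, hx, hx'⟩ := hSc i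
    rcases x with z | l
    · exact ⟨z, hx, hx'⟩
    · simp only [Sum.elim_inr, id] at hx'
      subst hx'
      exact absurd hx ((hC _).1 hi)
  have hdom : ∀ y : T, ∃ i ∈ C, ∀ x : T, Sum.inl x ∈ S → y.1 i ≤ x.1 i := by
    intro y
    obtain ⟨i, hi⟩ := hSD (Sum.inl y)
    refine ⟨i, (hC i).2 fun h => ?_, fun x hx => hlex y x i (hi _ hx)⟩
    have := hi _ h
    rw [hrr, hrl, if_pos rfl] at this
    omega
  obtain ⟨k0, hk0, -⟩ := hdom t0
  obtain ⟨z, hzS, hzc⟩ := hu k0 hk0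
  have hm : ∀ i, ∃ w : T, Sum.inl w ∈ S ∧ ∀ x : T, Sum.inl x ∈ S → w.1 i ≤ x.1 i := by
    intro i
    obtain ⟨w, hw, hw'⟩ := Finset.exists_min_image
      (Finset.univ.filter fun x : T => Sum.inl x ∈ S) (fun x => x.1 i) ⟨z, by simpa using hzS⟩
    exact ⟨w, by simpa using hw, fun x hx => hw' x (by simpa using hx)⟩
  choose w hwS hw using hm
  let m : I → ℕ := fun i => if i ∈ C then (w i).1 i else 0
  have hmx : ∀ x : T, Sum.inl x ∈ S → ∀ i, m i ≤ x.1 i := by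
    intro x hx i
    by_cases hi : i ∈ C
    · simp only [m, if_pos hi]; exact hw i x hx
    · simp [m, hi]
  have hsum : N ≤ ∑ i, m i + Fintype.card I := by
    by_contra! hlt
    have hlt' : ∑ i, (m i + 1) < N := by
      rw [Finset.sum_add_distrib]; simpa using hlt
    obtain ⟨q, hq⟩ := Nat.exists_eq_add_of_lt hlt'
    obtain ⟨i, hi, hi'⟩ := hdom ⟨fun i => (m i + 1) + (Pi.single k0 (q + 1) : I → ℕ) i, mkT _ (by
      rw [Finset.sum_add_distrib, Finset.sum_pi_single']; simp; omega)⟩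
    have h1 := hi' _ (hwS i)
    simp only [m, if_pos hi] at h1
    omega
  have hup : ∀ x : T, Sum.inl x ∈ S → ∀ l, x.1 l ≤ m l + Fintype.card I := by
    intro x hx l
    have h1 := hT x
    rw [← Finset.add_sum_erase _ _ (Finset.mem_univ l)] at h1
    rw [← Finset.add_sum_erase _ _ (Finset.mem_univ l)] at hsum
    have h2 : ∑ i ∈ Finset.univ.erase l, m i ≤ ∑ i ∈ Finset.univ.erase l, x.1 i :=
      Finset.sum_le_sum fun i _ => hmx x hx i
    omega
  refine ⟨z.1, hT z, fun i hi => ?_⟩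
  have hiC : i ∈ C := by
    by_contra hiC
    have := hup z hzS i
    simp only [m, if_neg hiC] at this
    omega
  obtain ⟨u, huS, huc⟩ := hu i hiC
  refine ⟨u.1, hT u, huc, fun l => ⟨?_, ?_⟩⟩
  · exact (hup z hzS l).trans (Nat.add_le_add_right (hmx u huS l) _)
  · exact (hup u huS l).trans (Nat.add_le_add_right (hmx z hzS l) _)

theorem fan_cover {I : Type*} [Fintype I] [Nonempty I] (F : I → Set (I → ℝ))
    (hF : ∀ i (p : ℕ → I → ℝ) (q : I → ℝ), (∀ n, p n ∈ stdSimplex ℝ I) → q ∈ stdSimplex ℝ I →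
      (∀ n, p n ∈ F i) → Tendsto p atTop (𝓝 q) → q ∈ F i)
    (hcov : ∀ p ∈ stdSimplex ℝ I, ∃ i, p ∈ F i) :
    ∃ q ∈ stdSimplex ℝ I, ∀ i, 0 < q i → q ∈ F i := by
  classical
  obtain ⟨i0⟩ := ‹Nonempty I›
  let P : ℕ → (I → ℕ) → I → ℝ := fun N z i => (z i : ℝ) / ((N : ℝ) + 1)
  have hP : ∀ N z, ∑ i, z i = N + 1 → P N z ∈ stdSimplex ℝ I := by
    intro N z hz
    refine ⟨fun i => by positivity, ?_⟩
    simp only [P]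
    rw [← Finset.sum_div, ← Nat.cast_sum, hz]
    push_cast
    exact div_self (by positivity)
  have hc : ∀ N : ℕ, ∃ c : (I → ℕ) → I, ∀ z, ∑ i, z i = N + 1 → P N z ∈ F (c z) := by
    intro N
    have : ∀ z : I → ℕ, ∃ i, ∑ i, z i = N + 1 → P N z ∈ F i := by
      intro z
      by_cases hz : ∑ i, z i = N + 1
      · obtain ⟨i, hi⟩ := hcov _ (hP N z hz)
        exact ⟨i, fun _ => hi⟩
      · exact ⟨i0, fun h => absurd h hz⟩
    choose c hc using this
    exact ⟨c, hc⟩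
  choose c hc using hc
  have hg := fun N : ℕ => scarf_grid i0 (N + 1) (c N)
  choose z hz hz' using hg
  obtain ⟨q, hq, φ, hφ, hlim⟩ := (isCompact_stdSimplex ℝ I).tendsto_subseq
    (fun N => hP N (z N) (hz N))
  refine ⟨q, hq, fun i hi => ?_⟩
  have hlim' : ∀ l, Tendsto (fun n => P (φ n) (z (φ n)) l) atTop (𝓝 (q l)) :=
    fun l => (tendsto_pi_nhds.1 hlim) l
  have hzero : Tendsto (fun n => (Fintype.card I : ℝ) / ((φ n : ℝ) + 1)) atTop (𝓝 0) := by
    have h1 : Tendsto (fun n : ℕ => (Fintype.card I : ℝ) / ((n : ℝ) + 1)) atTop (𝓝 0) := by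
      have := (tendsto_one_div_add_atTop_nhds_zero_nat (𝕜 := ℝ)).const_mul (Fintype.card I : ℝ)
      simpa [div_eq_mul_inv] using this
    exact h1.comp hφ.tendsto_atTop
  have hev : ∀ᶠ n in atTop, (Fintype.card I : ℝ) / ((φ n : ℝ) + 1) < P (φ n) (z (φ n)) i :=
    hzero.eventually_lt (hlim' i) hi
  obtain ⟨n0, hn0⟩ := eventually_atTop.1 hev
  have hex : ∀ n, ∃ u : I → ℕ, ∑ i, u i = φ (n + n0) + 1 ∧ c (φ (n + n0)) u = i ∧
      ∀ l, z (φ (n + n0)) l ≤ u l + Fintype.card I ∧ u l ≤ z (φ (n + n0)) l + Fintype.card I := by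
    intro n
    apply hz'
    have := hn0 (n + n0) (by omega)
    simp only [P] at this
    rw [div_lt_div_iff_of_pos_right (by positivity)] at this
    exact_mod_cast this
  choose u hu1 hu2 hu3 using hex
  refine hF i (fun n => P (φ (n + n0)) (u n)) q (fun n => hP _ _ (hu1 n)) hq
    (fun n => ?_) ?_
  · have := hc _ _ (hu1 n)
    rwa [hu2] at this
  · rw [tendsto_pi_nhds]
    intro l
    have h1 := (tendsto_add_atTop_iff_nat n0).2 (hlim' l)
    have h2 := (tendsto_add_atTop_iff_nat n0).2 hzero
    have h3 : Tendsto (fun n => P (φ (n + n0)) (z (φ (n + n0))) l -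
      (Fintype.card I : ℝ) / ((φ (n + n0) : ℝ) + 1)) atTop (𝓝 (q l)) := by
      simpa using h1.sub h2
    have h4 : Tendsto (fun n => P (φ (n + n0)) (z (φ (n + n0))) l +
      (Fintype.card I : ℝ) / ((φ (n + n0) : ℝ) + 1)) atTop (𝓝 (q l)) := by
      simpa using h1.add h2
    refine tendsto_of_tendsto_of_tendsto_of_le_of_le h3 h4 (fun n => ?_) (fun n => ?_)
    · have : (z (φ (n + n0)) l : ℝ) ≤ u n l + Fintype.card I := by exact_mod_cast (hu3 n l).1
      simp only [P]
      rw [← sub_div]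
      gcongr
      linarith
    · have : (u n l : ℝ) ≤ z (φ (n + n0)) l + Fintype.card I := by exact_mod_cast (hu3 n l).2
      simp only [P]
      rw [← add_div]
      gcongr

theorem himmelberg {E : Type*} [NormedAddCommGroup E] [NormedSpace ℝ E] (X D : Set E)
    (hXne : X.Nonempty) (hXcv : Convex ℝ X) (hD : IsCompact D) (hDX : D ⊆ X) (Φ : E → Set E)
    (hΦD : ∀ x ∈ X, Φ x ⊆ D) (hΦne : ∀ x ∈ X, (Φ x).Nonempty) (hΦcv : ∀ x ∈ X, Convex ℝ (Φ x))
    (hgr : ∀ (x w : ℕ → E) (x0 w0 : E), (∀ n, x n ∈ X) → x0 ∈ X → (∀ n, w n ∈ Φ (x n)) →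
      Tendsto x atTop (𝓝 x0) → Tendsto w atTop (𝓝 w0) → w0 ∈ Φ x0) :
    ∃ x ∈ X, x ∈ Φ x := by
  classical
  have step : ∀ ε : ℝ, 0 < ε → ∃ x ∈ X, ∃ w ∈ Φ x, ‖x - w‖ ≤ ε := by
    intro ε hε
    obtain ⟨t, htD, htf, htc⟩ := hD.finite_cover_balls hε
    obtain ⟨a, ha⟩ := hXne
    obtain ⟨b, hb⟩ := hΦne a ha
    have hbD := htc (hΦD a ha hb)
    simp only [mem_iUnion] at hbD
    obtain ⟨y0, hy0, -⟩ := hbD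
    have : Fintype t := htf.fintype
    have : Nonempty t := ⟨⟨y0, hy0⟩⟩
    let g : (t → ℝ) → E := fun p => ∑ i, p i • (i : E)
    have hgc : Continuous g := by fun_prop
    have hgX : ∀ p ∈ stdSimplex ℝ t, g p ∈ X := fun p hp =>
      hXcv.sum_mem (fun i _ => hp.1 i) hp.2 (fun i _ => hDX (htD i.2))
    obtain ⟨q, hq, hqF⟩ := fan_cover (I := t) (fun i => {p | ∃ w ∈ Φ (g p), ‖w - (i : E)‖ ≤ ε})
      (by
        intro i p q hp hq hpF hpq
        choose w hw hwi using hpF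
        obtain ⟨w0, -, φ, hφ, hlim⟩ := hD.tendsto_subseq
          (fun n => hΦD _ (hgX _ (hp n)) (hw n))
        refine ⟨w0, hgr (fun n => g (p (φ n))) (w ∘ φ) _ _ (fun n => hgX _ (hp _)) (hgX _ hq)
          (fun n => hw _) ?_ hlim, ?_⟩
        · exact ((hgc.tendsto q).comp hpq).comp hφ.tendsto_atTop
        · exact le_of_tendsto' (hlim.sub_const (i : E)).norm (fun n => hwi _))
      (by
        intro p hp
        obtain ⟨w, hw⟩ := hΦne _ (hgX p hp)
        have := htc (hΦD _ (hgX p hp) hw)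
        simp only [mem_iUnion] at this
        obtain ⟨y, hy, hwy⟩ := this
        refine ⟨⟨y, hy⟩, w, hw, ?_⟩
        rw [← dist_eq_norm]
        exact (Metric.mem_ball.1 hwy).le)
    have hw : ∀ i : t, ∃ w ∈ Φ (g q), 0 < q i → ‖w - (i : E)‖ ≤ ε := by
      intro i
      by_cases hi : 0 < q i
      · obtain ⟨w, hw, hw'⟩ := hqF i hi
        exact ⟨w, hw, fun _ => hw'⟩
      · obtain ⟨w, hw⟩ := hΦne _ (hgX q hq)
        exact ⟨w, hw, fun h => absurd h hi⟩
    choose w hw hwi using hw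
    refine ⟨g q, hgX q hq, ∑ i, q i • w i,
      (hΦcv _ (hgX q hq)).sum_mem (fun i _ => hq.1 i) hq.2 (fun i _ => hw i), ?_⟩
    rw [← Finset.sum_sub_distrib]
    calc ‖∑ i, (q i • (i : E) - q i • w i)‖ ≤ ∑ i, ‖q i • (i : E) - q i • w i‖ :=
          norm_sum_le _ _
      _ ≤ ∑ i, q i * ε := by
          refine Finset.sum_le_sum fun i _ => ?_
          rw [← smul_sub, norm_smul, Real.norm_of_nonneg (hq.1 i), norm_sub_rev]
          rcases (hq.1 i).eq_or_lt with h | h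
          · rw [← h]; simp
          · exact mul_le_mul_of_nonneg_left (hwi i h) h.le
      _ = ε := by rw [← Finset.sum_mul, hq.2, one_mul]
  have hseq := fun n : ℕ => step (1 / ((n : ℝ) + 1)) (by positivity)
  choose x hxX w hw hxw using hseq
  obtain ⟨w0, hw0, φ, hφ, hlim⟩ := hD.tendsto_subseq (fun n => hΦD _ (hxX n) (hw n))
  have h0 : Tendsto (fun n => x (φ n) - w (φ n)) atTop (𝓝 0) :=
    (squeeze_zero_norm hxw tendsto_one_div_add_atTop_nhds_zero_nat).comp hφ.tendsto_atTop
  have hx : Tendsto (fun n => x (φ n)) atTop (𝓝 w0) := by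
    simpa using h0.add hlim
  exact ⟨w0, hDX hw0, hgr _ _ _ _ (fun n => hxX _) (hDX hw0) (fun n => hw _) hx hlim⟩

/-- Existence of a best approximate solution for the quasi-optimization problem
QuOp(K,f) over a normed space. -/
theorem stmt11 {V : Type*} [NormedAddCommGroup V] [NormedSpace ℝ V]
    (U : Set V) (hUne : U.Nonempty) (hUcv : Convex ℝ U)
    (hAC : ∀ v : V, ∀ u : ℕ → V, (∀ n, u n ∈ U) →
      Tendsto (fun n => ‖v - u n‖) atTop (𝓝 (⨅ w : U, ‖v - (w : V)‖)) →
      ∃ φ : ℕ → ℕ, StrictMono φ ∧ ∃ l ∈ U, Tendsto (u ∘ φ) atTop (𝓝 l))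
    (f : V → ℝ) (hfc : Continuous f)
    (hfq : ∀ a b : V, ∀ t : ℝ, 0 ≤ t → t ≤ 1 → min (f a) (f b) ≤ f (t • a + (1 - t) • b))
    (K : ↥U → Set V)
    (hKusc : ∀ u : ↥U, ∀ W : Set V, IsOpen W → K u ⊆ W → ∀ᶠ u' in 𝓝 u, K u' ⊆ W)
    (hKlsc : ∀ u : ↥U, ∀ W : Set V, IsOpen W → (K u ∩ W).Nonempty →
      ∀ᶠ u' in 𝓝 u, (K u' ∩ W).Nonempty)
    (hKne : ∀ u, (K u).Nonempty) (hKcl : ∀ u, IsClosed (K u))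
    (hKcv : ∀ u, Convex ℝ (K u))
    (hKcpt : IsCompact (closure (⋃ u : ↥U, K u))) :
    ∃ u : ↥U, ∃ v : V,
      ‖v - (u : V)‖ = ⨅ w : U, ‖v - (w : V)‖ ∧
      v ∈ K u ∧ ∀ w ∈ K u, f w ≤ f v := by
  have hUn : Nonempty U := hUne.to_subtype
  obtain ⟨d, hd⟩ : ∃ d : V → ℝ, ∀ v, d v = ⨅ w : U, ‖v - (w : V)‖ := ⟨_, fun v => rfl⟩
  simp only [← hd] at hAC ⊢
  have hdle : ∀ v, ∀ u ∈ U, d v ≤ ‖v - u‖ := fun v u hu => by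
    rw [hd]
    exact ciInf_le (f := fun w : U => ‖v - (w : V)‖)
      ⟨0, by rintro _ ⟨w, rfl⟩; exact norm_nonneg _⟩ ⟨u, hu⟩
  have hdlip : ∀ v v', d v ≤ ‖v - v'‖ + d v' := fun v v' => by
    have : d v - ‖v - v'‖ ≤ d v' := by
      rw [hd v']
      refine le_ciInf fun w => ?_
      have h1 := hdle v w w.2
      have h2 := norm_sub_le_norm_sub_add_norm_sub v v' (w : V)
      linarith
    linarith
  have hdc : Continuous d := by
    have : LipschitzWith 1 d := LipschitzWith.of_le_add fun v v' => by
      rw [dist_eq_norm, add_comm]; exact hdlip v v'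
    exact this.continuous
  -- minimizing sequences with moving base points
  have hAC' : ∀ (v : V) (vn un : ℕ → V), Tendsto vn atTop (𝓝 v) → (∀ n, un n ∈ U) →
      (∀ n, ‖vn n - un n‖ = d (vn n)) →
      ∃ φ : ℕ → ℕ, StrictMono φ ∧ ∃ l ∈ U, Tendsto (un ∘ φ) atTop (𝓝 l) := by
    intro v vn un hv hu hvu
    refine hAC v un hu ?_
    have h1 : Tendsto (fun n => ‖v - vn n‖ + d (vn n)) atTop (𝓝 (d v)) := by
      have := (tendsto_const_nhds (x := v)).sub hv |>.norm.add ((hdc.tendsto v).comp hv)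
      simpa using this
    refine tendsto_of_tendsto_of_tendsto_of_le_of_le tendsto_const_nhds h1
      (fun n => hdle v _ (hu n)) (fun n => ?_)
    have h2 := norm_sub_le_norm_sub_add_norm_sub v (vn n) (un n)
    rw [hvu] at h2
    exact h2
  have hproj : ∀ v, ∃ u ∈ U, ‖v - u‖ = d v := by
    intro v
    have : ∀ n : ℕ, ∃ u : U, ‖v - (u : V)‖ < d v + 1 / ((n : ℝ) + 1) := fun n => by
      have h : (⨅ w : U, ‖v - (w : V)‖) < d v + 1 / ((n : ℝ) + 1) := by
        rw [← hd]; have : (0 : ℝ) < 1 / ((n : ℝ) + 1) := by positivity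
        linarith
      exact exists_lt_of_ciInf_lt h
    choose u hu using this
    have hlim : Tendsto (fun n => ‖v - (u n : V)‖) atTop (𝓝 (d v)) := by
      have h1 : Tendsto (fun n : ℕ => d v + 1 / ((n : ℝ) + 1)) atTop (𝓝 (d v)) := by
        simpa using (tendsto_one_div_add_atTop_nhds_zero_nat (𝕜 := ℝ)).const_add (d v)
      exact tendsto_of_tendsto_of_tendsto_of_le_of_le tendsto_const_nhds h1
        (fun n => hdle v _ (u n).2) (fun n => (hu n).le)
    obtain ⟨φ, hφ, l, hl, hl'⟩ := hAC v (fun n => u n) (fun n => (u n).2) hlim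
    exact ⟨l, hl, tendsto_nhds_unique (hl'.const_sub v).norm (hlim.comp hφ.tendsto_atTop)⟩
  set C : Set V := closure (⋃ u : ↥U, K u) with hCdef
  have hKC : ∀ u, K u ⊆ C := fun u => (subset_iUnion K u).trans subset_closure
  have hP : ∀ C' : Set V, IsCompact C' → IsCompact {u | u ∈ U ∧ ∃ v ∈ C', ‖v - u‖ = d v} := by
    intro C' hC'
    rw [isCompact_iff_isSeqCompact]
    intro un hun
    choose hu vn hvn huv using hun
    obtain ⟨v, hv, φ, hφ, hlim⟩ := hC'.tendsto_subseq hvn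
    obtain ⟨ψ, hψ, l, hl, hlim'⟩ := hAC' v (vn ∘ φ) (un ∘ φ) hlim (fun n => hu _) (fun n => huv _)
    refine ⟨l, ⟨hl, v, hv, ?_⟩, φ ∘ ψ, hφ.comp hψ, hlim'⟩
    have h1 := hlim.comp hψ.tendsto_atTop
    refine tendsto_nhds_unique (h1.sub hlim').norm ?_
    have h2 := (hdc.tendsto v).comp h1
    refine h2.congr fun n => ?_
    exact (huv _).symm
  -- graph of `K` is closed
  have hKgr : ∀ (u : ℕ → U) (w : ℕ → V) (u0 : U) (w0 : V), (∀ n, w n ∈ K (u n)) →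
      Tendsto u atTop (𝓝 u0) → Tendsto w atTop (𝓝 w0) → w0 ∈ K u0 := by
    intro u w u0 w0 hw hu hw0
    by_contra hcon
    obtain ⟨ε, hε, hball⟩ := Metric.isOpen_iff.1 (hKcl u0).isOpen_compl w0 hcon
    have h1 := hKusc u0 (Metric.closedBall w0 (ε / 2))ᶜ Metric.isClosed_closedBall.isOpen_compl
      (fun z hz hz' => hball (Metric.closedBall_subset_ball (by linarith) hz') hz)
    have h2 : ∀ᶠ n in atTop, w n ∈ Metric.closedBall w0 (ε / 2) :=
      hw0.eventually (Metric.closedBall_mem_nhds w0 (by linarith))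
    obtain ⟨n, hn1, hn2⟩ := ((hu.eventually h1).and h2).exists
    exact hn1 (hw n) hn2
  -- the argmax map
  obtain ⟨F, hF⟩ : ∃ F : U → Set V, ∀ u w, w ∈ F u ↔ w ∈ K u ∧ ∀ z ∈ K u, f z ≤ f w :=
    ⟨fun u => {w | w ∈ K u ∧ ∀ z ∈ K u, f z ≤ f w}, fun u w => Iff.rfl⟩
  have hFne : ∀ u, (F u).Nonempty := by
    intro u
    obtain ⟨w, hw, hw'⟩ := (hKcpt.of_isClosed_subset (hKcl u) (hKC u)).exists_isMaxOn (hKne u)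
      hfc.continuousOn
    exact ⟨w, (hF u w).2 ⟨hw, fun z hz => hw' hz⟩⟩
  have hFC : ∀ u, F u ⊆ C := fun u w hw => hKC u ((hF u w).1 hw).1
  have hFcv : ∀ u, Convex ℝ (F u) := by
    intro u a ha b hb s t hs ht hst
    rw [hF] at ha hb ⊢
    refine ⟨hKcv u ha.1 hb.1 hs ht hst, fun z hz => ?_⟩
    have h1 := hfq a b s hs (by linarith)
    rw [show (1 : ℝ) - s = t by linarith] at h1
    exact (le_min (ha.2 z hz) (hb.2 z hz)).trans h1
  have hFgr : ∀ (u : ℕ → U) (w : ℕ → V) (u0 : U) (w0 : V), (∀ n, w n ∈ F (u n)) →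
      Tendsto u atTop (𝓝 u0) → Tendsto w atTop (𝓝 w0) → w0 ∈ F u0 := by
    intro u w u0 w0 hw hu hw0
    rw [hF]
    refine ⟨hKgr u w u0 w0 (fun n => ((hF _ _).1 (hw n)).1) hu hw0, fun z hz => ?_⟩
    refine le_of_forall_lt fun a ha => ?_
    obtain ⟨b, hab, hbz⟩ := exists_between ha
    have h1 := hKlsc u0 (f ⁻¹' Ioi b) (isOpen_Ioi.preimage hfc) ⟨z, hz, hbz⟩
    refine hab.trans_le (ge_of_tendsto ((hfc.tendsto w0).comp hw0) ?_)
    filter_upwards [hu.eventually h1] with n hn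
    obtain ⟨y, hy, hby⟩ := hn
    exact (le_of_lt hby).trans (((hF _ _).1 (hw n)).2 y hy)
  -- approximate solutions
  have step : ∀ ε : ℝ, 0 < ε → ∃ u : U, ∃ v w : V, ‖v - (u : V)‖ = d v ∧ w ∈ F u ∧ ‖v - w‖ ≤ ε := by
    intro ε hε
    obtain ⟨t, htC, htf, htc⟩ := hKcpt.finite_cover_balls hε
    let C' : Set V := convexHull ℝ t
    have hC'c : IsCompact C' := htf.isCompact_convexHull (𝕜 := ℝ)
    have hC'cv : Convex ℝ C' := convex_convexHull ℝ t
    have hnear : ∀ w ∈ C, ∃ y ∈ C', ‖y - w‖ ≤ ε := by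
      intro w hw
      have := htc hw
      simp only [mem_iUnion] at this
      obtain ⟨y, hy, hwy⟩ := this
      refine ⟨y, subset_convexHull ℝ t hy, ?_⟩
      rw [← dist_eq_norm, dist_comm]
      exact (Metric.mem_ball.1 hwy).le
    have hC'ne : C'.Nonempty := by
      obtain ⟨w, hw⟩ := hFne (Classical.arbitrary U)
      obtain ⟨y, hy, -⟩ := hnear w (hFC _ hw)
      exact ⟨y, hy⟩
    let Φ : V × V → Set (V × V) := fun p => {q | (q.1 ∈ U ∧ ‖p.2 - q.1‖ = d p.2) ∧
      q.2 ∈ C' ∧ ∃ h : p.1 ∈ U, ∃ w ∈ F ⟨p.1, h⟩, ‖q.2 - w‖ ≤ ε}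
    obtain ⟨p, -, ⟨hp1, hp2⟩, -, hpU, w, hw, hpw⟩ := himmelberg (U ×ˢ C')
      ({u | u ∈ U ∧ ∃ v ∈ C', ‖v - u‖ = d v} ×ˢ C')
      (hUne.prod hC'ne) (hUcv.prod hC'cv) ((hP C' hC'c).prod hC'c)
      (fun q hq => ⟨hq.1.1, hq.2⟩) Φ
      (fun p hp q hq => ⟨⟨hq.1.1, p.2, hp.2, hq.1.2⟩, hq.2.1⟩)
      (by
        rintro p ⟨hp1, hp2⟩
        obtain ⟨u, hu, hu'⟩ := hproj p.2
        obtain ⟨w, hw⟩ := hFne ⟨p.1, hp1⟩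
        obtain ⟨y, hy, hy'⟩ := hnear w (hFC _ hw)
        exact ⟨(u, y), ⟨hu, hu'⟩, hy, hp1, w, hw, hy'⟩)
      (by
        rintro p ⟨hp1, hp2⟩ a ⟨⟨ha1, ha2⟩, ha3, hU1, w, hw, haw⟩ b
          ⟨⟨hb1, hb2⟩, hb3, hU2, w', hw', hbw⟩ s t hs ht hst
        have hU' := hUcv ha1 hb1 hs ht hst
        refine ⟨⟨hU', le_antisymm ?_ (hdle _ _ hU')⟩, hC'cv ha3 hb3 hs ht hst, hp1,
          s • w + t • w', hFcv _ hw hw' hs ht hst, ?_⟩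
        · have h1 : p.2 - (s • a + t • b).1 = s • (p.2 - a.1) + t • (p.2 - b.1) := by
            have : p.2 = s • p.2 + t • p.2 := by rw [← add_smul, hst, one_smul]
            simp only [Prod.fst_add, Prod.smul_fst, smul_sub]
            nth_rewrite 1 [this]
            abel
          rw [h1]
          refine (norm_add_le _ _).trans ?_
          rw [norm_smul, norm_smul, Real.norm_of_nonneg hs, Real.norm_of_nonneg ht, ha2, hb2,
            ← add_mul, hst, one_mul]
        · have h1 : (s • a + t • b).2 - (s • w + t • w') = s • (a.2 - w) + t • (b.2 - w') := by
            simp only [Prod.snd_add, Prod.smul_snd, smul_sub]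
            abel
          rw [h1]
          refine (norm_add_le _ _).trans ?_
          rw [norm_smul, norm_smul, Real.norm_of_nonneg hs, Real.norm_of_nonneg ht]
          calc s * ‖a.2 - w‖ + t * ‖b.2 - w'‖ ≤ s * ε + t * ε := by gcongr
            _ = ε := by rw [← add_mul, hst, one_mul])
      (by
        intro x q x0 q0 hx hx0 hq hxl hql
        have hx1 := (continuous_fst.tendsto x0).comp hxl
        have hx2 := (continuous_snd.tendsto x0).comp hxl
        have hq1 := (continuous_fst.tendsto q0).comp hql
        have hq2 := (continuous_snd.tendsto q0).comp hql
        have hqd : ‖x0.2 - q0.1‖ = d x0.2 :=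
          tendsto_nhds_unique (hx2.sub hq1).norm
            (((hdc.tendsto _).comp hx2).congr fun n => ((hq n).1.2).symm)
        have hex : ∀ n, ∃ w ∈ F ⟨(x n).1, (hx n).1⟩, ‖(q n).2 - w‖ ≤ ε := fun n => by
          obtain ⟨-, -, h, w, hw, hw'⟩ := hq n
          exact ⟨w, hw, hw'⟩
        have hqU : q0.1 ∈ U := by
          obtain ⟨φ, hφ, l, hl, hl'⟩ := hAC' x0.2 (fun n => (x n).2) (fun n => (q n).1) hx2
            (fun n => (hq n).1.1) (fun n => (hq n).1.2)
          rwa [tendsto_nhds_unique (hq1.comp hφ.tendsto_atTop) hl']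
        choose w hw hw' using hex
        obtain ⟨w0, -, φ, hφ, hlim⟩ := hKcpt.tendsto_subseq (fun n => hFC _ (hw n))
        refine ⟨⟨hqU, hqd⟩, hC'c.isClosed.mem_of_tendsto hq2
          (Eventually.of_forall fun n => (hq n).2.1), hx0.1, w0, ?_, ?_⟩
        · refine hFgr (fun n => ⟨(x (φ n)).1, (hx (φ n)).1⟩) (w ∘ φ) _ _ (fun n => hw _) ?_ hlim
          rw [tendsto_subtype_rng]
          exact hx1.comp hφ.tendsto_atTop
        · exact le_of_tendsto' ((hq2.comp hφ.tendsto_atTop).sub hlim).norm (fun n => hw' _))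
    exact ⟨⟨p.1, hpU⟩, p.2, w, hp2, hw, hpw⟩
  have hseq := fun n : ℕ => step (1 / ((n : ℝ) + 1)) (by positivity)
  choose u v w huv hw hvw using hseq
  obtain ⟨w0, -, φ, hφ, hlim⟩ := hKcpt.tendsto_subseq (fun n => hFC _ (hw n))
  have h0 : Tendsto (fun n => v (φ n) - w (φ n)) atTop (𝓝 0) :=
    (squeeze_zero_norm hvw tendsto_one_div_add_atTop_nhds_zero_nat).comp hφ.tendsto_atTop
  have hv : Tendsto (fun n => v (φ n)) atTop (𝓝 w0) := by
    simpa using h0.add hlim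
  obtain ⟨ψ, hψ, l, hl, hl'⟩ := hAC' w0 (fun n => v (φ n)) (fun n => u (φ n)) hv
    (fun n => (u _).2) (fun n => huv _)
  have hv' := hv.comp hψ.tendsto_atTop
  have hmem : w0 ∈ F ⟨l, hl⟩ := by
    refine hFgr (fun n => u (φ (ψ n))) (fun n => w (φ (ψ n))) _ _ (fun n => hw _) ?_
      (hlim.comp hψ.tendsto_atTop)
    rw [tendsto_subtype_rng]
    exact hl'
  rw [hF] at hmem
  refine ⟨⟨l, hl⟩, w0, ?_, hmem.1, hmem.2⟩
  exact tendsto_nhds_unique (hv'.sub hl').norm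
    (((hdc.tendsto _).comp hv').congr fun n => (huv _).symm)
end

section
/- Let V be a normed space, U ⊆ V nonempty, convex and approximatively compact, K : U → 2^V a continuous self-contained map (K(U) ⊆ U is not required) with nonempty closed convex values and with closure of K(U) compact, and f : V → ℝ continuous quasi-concave. Then the composition Γ = Pr ∘ M : U → 2^U, where M(u) = argmax_{K(u)} f and Pr is the best approximation map onto U, has a fixed point. -/
open Filter Topology Set

namespace Scarf

def Dom {T I : Type*} (k : I → T → ℕ) (σ : Finset T) (C : Finset I) : Prop :=
  ∀ y, ∃ i ∈ C, ∀ x ∈ σ, k i y ≤ k i x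

def Adj {T I : Type*} [DecidableEq T] [DecidableEq I] (r d : Finset T × Finset I) : Prop :=
  (∃ x ∈ r.1, d = (r.1.erase x, r.2)) ∨ (∃ j, j ∉ r.2 ∧ d = (r.1, insert j r.2))

def Room {T I : Type*} (k : I → T → ℕ) (r : Finset T × Finset I) : Prop :=
  Dom k r.1 r.2 ∧ r.1.card = r.2.card

theorem cell_inj {T I : Type*} [DecidableEq T] [DecidableEq I] {k : I → T → ℕ}
    (hk : ∀ i, Function.Injective (k i)) {σ : Finset T} {C : Finset I} (hd : Dom k σ C)
    (hc : C.card ≤ σ.card) {x : T} (hx : x ∈ σ) {i j : I} (hi : i ∈ C) (hj : j ∈ C)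
    (hxi : ∀ x' ∈ σ, k i x ≤ k i x') (hxj : ∀ x' ∈ σ, k j x ≤ k j x') : i = j := by
  by_contra hij
  have h1 : ∀ x' ∈ σ, ∃ l ∈ C.erase i, ∀ z ∈ σ, k l x' ≤ k l z := by
    intro x' hx'
    obtain ⟨l, hl, hl'⟩ := hd x'
    by_cases hli : l = i
    · subst hli
      have : x' = x := hk l (le_antisymm (hl' x hx) (hxi x' hx'))
      subst this
      exact ⟨j, Finset.mem_erase.2 ⟨fun h => hij h.symm, hj⟩, hxj⟩
    · exact ⟨l, Finset.mem_erase.2 ⟨hli, hl⟩, hl'⟩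
  have : Nonempty I := ⟨i⟩
  choose! g hg hg' using h1
  have h2 : σ.card ≤ (C.erase i).card := by
    apply Finset.card_le_card_of_injOn g (fun x hx => hg x hx)
    intro a ha b hb hab
    have h3 := hg' a ha b hb
    have h4 := hg' b hb a ha
    rw [← hab] at h4
    exact hk _ (le_antisymm h3 h4)
  rw [Finset.card_erase_of_mem hi] at h2
  have := Finset.card_pos.2 ⟨i, hi⟩
  omega

theorem door_two {T I : Type*} [Fintype T] [DecidableEq T] [DecidableEq I] {k : I → T → ℕ}
    (hk : ∀ i, Function.Injective (k i)) {τ : Finset T} {D : Finset I} (hd : Dom k τ D)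
    (hne : τ.Nonempty) (hc : D.card = τ.card + 1) :
    ∃ r₁ r₂ : Finset T × Finset I, r₁ ≠ r₂ ∧
      ∀ r, (Room k r ∧ Adj r (τ, D)) ↔ (r = r₁ ∨ r = r₂) := by
  classical
  have h0 : ∀ i : I, ∃ x ∈ τ, ∀ x' ∈ τ, k i x ≤ k i x' := fun i => Finset.exists_min_image τ (k i) hne
  choose m hm hmin using h0
  have hmu : ∀ i, ∀ x ∈ τ, (∀ x' ∈ τ, k i x ≤ k i x') → x = m i := fun i x hx h =>
    hk i (le_antisymm (h _ (hm i)) (hmin i x hx))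
  let P : I → (Finset T × Finset I) → Prop := fun e r =>
    (r = (τ, D.erase e) ∧ Dom k τ (D.erase e)) ∨
      ∃ y, y ∉ τ ∧ r = (insert y τ, D) ∧ Dom k (insert y τ) D ∧ ∀ x ∈ τ, k e y < k e x
  -- existence and uniqueness
  have hins : ∀ e ∈ D, ∀ y, y ∉ τ → Dom k (insert y τ) D → (∀ x ∈ τ, k e y < k e x) →
      ∀ i ∈ D.erase e, k i (m i) < k i y := by
    intro e he y hy hdy hlt i hi
    by_contra hcon
    push Not at hcon
    have hi' := Finset.mem_erase.1 hi
    apply hi'.1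
    refine cell_inj hk hdy (by rw [Finset.card_insert_of_notMem hy, hc]) (Finset.mem_insert_self y τ) hi'.2 he ?_ ?_
    · intro x' hx'
      rcases Finset.mem_insert.1 hx' with rfl | h
      · exact le_rfl
      · exact hcon.trans (hmin i x' h)
    · intro x' hx'
      rcases Finset.mem_insert.1 hx' with rfl | h
      · exact le_rfl
      · exact (hlt x' h).le
  have hex : ∀ e ∈ D, (∀ x ∈ τ, ∃ i ∈ D.erase e, x = m i) → ∃ r, P e r ∧ ∀ r', P e r' → r' = r := by
    intro e he him
    let S : Finset T := Finset.univ.filter (fun y => ∀ i ∈ D.erase e, k i (m i) < k i y)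
    have hS : ∀ y, y ∈ S ↔ ∀ i ∈ D.erase e, k i (m i) < k i y := by intro y; simp [S]
    by_cases hSe : S.Nonempty
    · obtain ⟨y, hyS, hymax⟩ := Finset.exists_max_image S (k e) hSe
      have hy := (hS y).1 hyS
      have hyτ : y ∉ τ := by
        intro h
        obtain ⟨i, hi, rfl⟩ := him y h
        have := (hy i hi)
        exact absurd (hmin i _ h) (by omega)
      have hlt : ∀ x ∈ τ, k e y < k e x := by
        obtain ⟨i, hi, hle⟩ := hd y
        have hie : i = e := by
          by_contra hie
          have := hy i (Finset.mem_erase.2 ⟨hie, hi⟩)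
          have := hle _ (hm i)
          omega
        subst hie
        intro x hx
        refine lt_of_le_of_ne (hle x hx) fun h => hyτ ?_
        rw [hk _ h]; exact hx
      refine ⟨(insert y τ, D), Or.inr ⟨y, hyτ, rfl, ?_, hlt⟩, ?_⟩
      · intro z
        by_cases hz : z ∈ S
        · refine ⟨e, he, fun x hx => ?_⟩
          have := hymax z hz
          rcases Finset.mem_insert.1 hx with rfl | h
          · exact this
          · exact this.trans (hlt x h).le
        · rw [hS] at hz
          push Not at hz
          obtain ⟨i, hi, hle⟩ := hz
          refine ⟨i, (Finset.mem_erase.1 hi).2, fun x hx => ?_⟩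
          rcases Finset.mem_insert.1 hx with rfl | h
          · exact hle.trans (hy i hi).le
          · exact hle.trans (hmin i x h)
      · rintro r' (⟨rfl, hdom⟩ | ⟨y', hy', rfl, hdom, hlt'⟩)
        · obtain ⟨i, hi, hle⟩ := hdom y
          have := hle _ (hm i)
          have := hy i hi
          omega
        · have hy'S := (hS y').2 (hins e he y' hy' hdom hlt')
          obtain ⟨i, hi, hle⟩ := hdom y
          have hie : i = e := by
            by_contra hie
            have := hy i (Finset.mem_erase.2 ⟨hie, hi⟩)
            have := hle _ (Finset.mem_insert_of_mem (hm i))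
            omega
          subst hie
          have := hk i (le_antisymm (hle y' (Finset.mem_insert_self _ _)) (hymax _ hy'S))
          rw [this]
    · have hSn : ∀ y, ∃ i ∈ D.erase e, k i y ≤ k i (m i) := by
        intro y
        by_contra hcon
        push Not at hcon
        exact hSe ⟨y, (hS y).2 hcon⟩
      refine ⟨(τ, D.erase e), Or.inl ⟨rfl, ?_⟩, ?_⟩
      · intro y
        obtain ⟨i, hi, hle⟩ := hSn y
        exact ⟨i, hi, fun x hx => hle.trans (hmin i x hx)⟩
      · rintro r' (⟨rfl, hdom⟩ | ⟨y', hy', rfl, hdom, hlt'⟩)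
        · rfl
        · exact absurd ⟨y', (hS y').2 (hins e he y' hy' hdom hlt')⟩ hSe
  -- two indices
  obtain ⟨a, ha, b, hb, hab, hmab⟩ := Finset.exists_ne_map_eq_of_card_lt_of_maps_to
    (s := D) (t := τ) (f := m) (by omega) (fun i _ => hm i)
  have himD : ∀ x ∈ τ, ∃ i ∈ D, x = m i := by
    intro x hx
    obtain ⟨i, hi, hle⟩ := hd x
    exact ⟨i, hi, hmu i x hx hle⟩
  have hima : ∀ x ∈ τ, ∃ i ∈ D.erase a, x = m i := by
    intro x hx
    obtain ⟨i, hi, rfl⟩ := himD x hx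
    by_cases h : i = a
    · subst h
      exact ⟨b, Finset.mem_erase.2 ⟨hab.symm, hb⟩, hmab⟩
    · exact ⟨i, Finset.mem_erase.2 ⟨h, hi⟩, rfl⟩
  have himb : ∀ x ∈ τ, ∃ i ∈ D.erase b, x = m i := by
    intro x hx
    obtain ⟨i, hi, rfl⟩ := himD x hx
    by_cases h : i = b
    · subst h
      exact ⟨a, Finset.mem_erase.2 ⟨hab, ha⟩, hmab.symm⟩
    · exact ⟨i, Finset.mem_erase.2 ⟨h, hi⟩, rfl⟩
  have honly : ∀ e ∈ D, (∀ x ∈ τ, ∃ i ∈ D.erase e, x = m i) → e = a ∨ e = b := by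
    intro e he him
    by_contra hcon
    push Not at hcon
    have hsub : τ ⊆ (D.erase e).image m := by
      intro x hx
      obtain ⟨i, hi, rfl⟩ := him x hx
      exact Finset.mem_image_of_mem _ hi
    have hcard : (D.erase e).card = τ.card := by rw [Finset.card_erase_of_mem he]; omega
    have h1 := Finset.card_le_card hsub
    have h2 : ((D.erase e).image m).card = (D.erase e).card :=
      le_antisymm Finset.card_image_le (by omega)
    have h3 := Finset.card_image_iff.1 h2
    exact hab (h3 (by simp [ha, hcon.1.symm]) (by simp [hb, hcon.2.symm]) hmab)
  obtain ⟨r₁, hr₁, hu₁⟩ := hex a ha hima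
  obtain ⟨r₂, hr₂, hu₂⟩ := hex b hb himb
  have hPR : ∀ e ∈ D, ∀ r, P e r → Room k r ∧ Adj r (τ, D) := by
    rintro e he r (⟨rfl, hdom⟩ | ⟨y, hy, rfl, hdom, hlt⟩)
    · refine ⟨⟨hdom, ?_⟩, Or.inr ⟨e, by simp, ?_⟩⟩
      · simp only; rw [Finset.card_erase_of_mem he]; omega
      · simp only; rw [Finset.insert_erase he]
    · refine ⟨⟨hdom, ?_⟩, Or.inl ⟨y, by simp, ?_⟩⟩
      · simp only; rw [Finset.card_insert_of_notMem hy]; omega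
      · simp only; rw [Finset.erase_insert hy]
  refine ⟨r₁, r₂, ?_, fun r => ⟨?_, ?_⟩⟩
  · rintro rfl
    rcases hr₁ with ⟨h1, hdom⟩ | ⟨y, hy, h1, hdom, hlt⟩ <;>
      rcases hr₂ with ⟨h2, hdom'⟩ | ⟨y', hy', h2, hdom', hlt'⟩
    · rw [h1] at h2
      have h3 := (Prod.mk.inj h2).2
      have : a ∈ D.erase b := Finset.mem_erase.2 ⟨hab, ha⟩
      rw [← h3] at this
      simp at this
    · rw [h1] at h2
      have h3 := (Prod.mk.inj h2).2
      rw [← h3] at ha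
      simp at ha
    · rw [h1] at h2
      have h3 := (Prod.mk.inj h2).2
      rw [h3] at hb
      simp at hb
    · rw [h1] at h2
      have h3 := (Prod.mk.inj h2).1
      have h4 : y = y' := by
        have : y ∈ insert y' τ := by rw [← h3]; simp
        rcases Finset.mem_insert.1 this with h | h
        · exact h
        · exact absurd h hy
      subst h4
      have h5 := hins a ha y hy hdom hlt b (Finset.mem_erase.2 ⟨hab.symm, hb⟩)
      have h6 := hlt' _ (hm b)
      omega
  · rintro ⟨⟨hdom, hcard⟩, hadj⟩
    suffices h : ∃ e ∈ D, (∀ x ∈ τ, ∃ i ∈ D.erase e, x = m i) ∧ P e r by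
      obtain ⟨e, he, him, hP⟩ := h
      rcases honly e he him with rfl | rfl
      · exact Or.inl (hu₁ r hP)
      · exact Or.inr (hu₂ r hP)
    obtain ⟨s, C⟩ := r
    rcases hadj with ⟨y, hy, h⟩ | ⟨j, hj, h⟩
    · obtain ⟨h1, h2⟩ := Prod.mk.inj h
      simp only at hy h1 h2 hdom hcard
      subst h2
      have hyτ : y ∉ τ := by rw [h1]; simp
      have hs : s = insert y τ := by rw [h1, Finset.insert_erase hy]
      subst hs
      obtain ⟨e, he, hle⟩ := hdom y
      have hlt : ∀ x ∈ τ, k e y < k e x := by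
        intro x hx
        refine lt_of_le_of_ne (hle x (Finset.mem_insert_of_mem hx)) fun h => hyτ ?_
        rw [hk _ h]; exact hx
      refine ⟨e, he, ?_, Or.inr ⟨y, hyτ, rfl, hdom, hlt⟩⟩
      intro x hx
      obtain ⟨i, hi, hle'⟩ := hdom x
      refine ⟨i, Finset.mem_erase.2 ⟨?_, hi⟩, hmu i x hx fun x' hx' => hle' x' (Finset.mem_insert_of_mem hx')⟩
      rintro rfl
      have := hlt x hx
      have := hle' y (Finset.mem_insert_self _ _)
      omega
    · obtain ⟨h1, h2⟩ := Prod.mk.inj h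
      simp only at hj h1 h2 hdom hcard
      subst h1
      have hC : C = D.erase j := by rw [h2, Finset.erase_insert hj]
      subst hC
      have hjD : j ∈ D := by rw [h2]; simp
      refine ⟨j, hjD, ?_, Or.inl ⟨rfl, hdom⟩⟩
      intro x hx
      obtain ⟨i, hi, hle'⟩ := hdom x
      exact ⟨i, hi, hmu i x hx hle'⟩
  · rintro (rfl | rfl)
    · exact hPR a ha _ hr₁
    · exact hPR b hb _ hr₂

def Door {T I : Type*} [DecidableEq I] (c : T → I) (i : I) (d : Finset T × Finset I) : Prop :=
  i ∈ d.2 ∧ d.1.image c = d.2.erase i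

theorem room_even {T I : Type*} [DecidableEq T] [DecidableEq I]
    (c : T → I) (i : I) (r : Finset T × Finset I) (hcard : r.1.card = r.2.card)
    (hnc : r.1.image c ≠ r.2) :
    (∀ d, ¬ (Adj r d ∧ Door c i d)) ∨
    ∃ d₁ d₂ : Finset T × Finset I, d₁ ≠ d₂ ∧ ∀ d, (Adj r d ∧ Door c i d) ↔ (d = d₁ ∨ d = d₂) := by
  classical
  obtain ⟨s, C⟩ := r
  simp only at hcard hnc
  by_cases hcond : i ∈ C ∧ C.erase i ⊆ s.image c
  swap
  · left
    rintro d ⟨⟨x, hx, rfl⟩ | ⟨j, hj, rfl⟩, hi, him⟩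
    · apply hcond
      refine ⟨hi, ?_⟩
      simp only at him
      rw [← him]
      exact Finset.image_subset_image (Finset.erase_subset _ _)
    · simp only at hi him hj
      by_cases hji : j = i
      · subst hji
        rw [Finset.erase_insert hj] at him
        exact hnc him
      · apply hcond
        refine ⟨(Finset.mem_insert.1 hi).resolve_left (fun h => hji h.symm), ?_⟩
        rw [him]
        exact Finset.erase_subset_erase _ (Finset.subset_insert _ _)
  obtain ⟨hi, hsub⟩ := hcond
  right
  have hCe : (C.erase i).card + 1 = C.card := Finset.card_erase_add_one hi
  by_cases heq : s.image c = C.erase i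
  · obtain ⟨x, hx, x', hx', hne, hcx⟩ := Finset.exists_ne_map_eq_of_card_lt_of_maps_to
      (s := s) (t := C.erase i) (f := c) (by omega)
      (fun x hx => by rw [← heq]; exact Finset.mem_image_of_mem c hx)
    have key : ∀ z ∈ s, (s.erase z).image c = C.erase i ↔ (z = x ∨ z = x') := by
      intro z hz
      constructor
      · intro h
        by_contra hcon
        push Not at hcon
        have h2 : ((s.erase z).image c).card = (s.erase z).card := by
          have := Finset.card_erase_add_one hz
          rw [h]; omega
        have h3 := Finset.card_image_iff.1 h2
        exact hne (h3 (by simp [hx, hcon.1.symm]) (by simp [hx', hcon.2.symm]) hcx)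
      · intro h
        rw [← heq]
        apply Finset.Subset.antisymm (Finset.image_subset_image (Finset.erase_subset _ _))
        intro l hl
        obtain ⟨w, hw, rfl⟩ := Finset.mem_image.1 hl
        by_cases hwz : w = z
        · subst hwz
          rcases h with rfl | rfl
          · rw [hcx]; exact Finset.mem_image_of_mem c (Finset.mem_erase.2 ⟨hne.symm, hx'⟩)
          · rw [← hcx]; exact Finset.mem_image_of_mem c (Finset.mem_erase.2 ⟨hne, hx⟩)
        · exact Finset.mem_image_of_mem c (Finset.mem_erase.2 ⟨hwz, hw⟩)
    refine ⟨(s.erase x, C), (s.erase x', C), ?_, ?_⟩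
    · intro h
      have h1 := (Prod.mk.inj h).1
      have : x' ∈ s.erase x := Finset.mem_erase.2 ⟨hne.symm, hx'⟩
      rw [h1] at this
      simp at this
    · intro d
      constructor
      · rintro ⟨⟨z, hz, rfl⟩ | ⟨j, hj, rfl⟩, hi', him⟩
        · rcases (key z hz).1 him with rfl | rfl
          · exact Or.inl rfl
          · exact Or.inr rfl
        · simp only at hi' him hj
          rw [heq] at him
          have h1 := Finset.card_erase_add_one hi'
          rw [← him, Finset.card_insert_of_notMem hj] at h1
          omega
      · rintro (rfl | rfl)
        · exact ⟨Or.inl ⟨x, hx, rfl⟩, hi, (key x hx).2 (Or.inl rfl)⟩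
        · exact ⟨Or.inl ⟨x', hx', rfl⟩, hi, (key x' hx').2 (Or.inr rfl)⟩
  · have hss : C.erase i ⊂ s.image c := lt_of_le_of_ne hsub (fun h => heq h.symm)
    have hlt := Finset.card_lt_card hss
    have hle : (s.image c).card ≤ s.card := Finset.card_image_le
    have hinj := Finset.card_image_iff.1 (show (s.image c).card = s.card by omega)
    obtain ⟨j, hjs, hjC⟩ := Finset.exists_of_ssubset hss
    have him : s.image c = insert j (C.erase i) := by
      symm
      apply Finset.eq_of_subset_of_card_le
      · exact Finset.insert_subset hjs hsub
      · rw [Finset.card_insert_of_notMem hjC]; omega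
    have hji : j ≠ i := by
      rintro rfl
      rw [Finset.insert_erase hi] at him
      exact hnc him
    have hjC' : j ∉ C := fun h => hjC (Finset.mem_erase.2 ⟨hji, h⟩)
    obtain ⟨x, hx, hcx⟩ := Finset.mem_image.1 hjs
    refine ⟨(s, insert j C), (s.erase x, C), ?_, ?_⟩
    · intro h
      have h1 := (Prod.mk.inj h).2
      exact hjC' (by rw [← h1]; simp)
    · intro d
      constructor
      · rintro ⟨⟨z, hz, rfl⟩ | ⟨l, hl, rfl⟩, hi', him'⟩
        · right
          simp only at him'
          have : z = x := by
            by_contra hzx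
            have : c x ∈ (s.erase z).image c :=
              Finset.mem_image_of_mem c (Finset.mem_erase.2 ⟨fun h => hzx h.symm, hx⟩)
            rw [him', hcx] at this
            exact hjC this
          rw [this]
        · left
          simp only at him' hl
          rw [him'] at hjs
          have := (Finset.mem_insert.1 (Finset.mem_erase.1 hjs).2).resolve_right hjC'
          rw [this]
      · rintro (rfl | rfl)
        · refine ⟨Or.inr ⟨j, hjC', rfl⟩, Finset.mem_insert_of_mem hi, ?_⟩
          simp only
          rw [him, Finset.erase_insert_of_ne hji]
        · refine ⟨Or.inl ⟨x, hx, rfl⟩, hi, ?_⟩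
          simp only
          apply Finset.Subset.antisymm
          · intro l hl
            obtain ⟨w, hw, rfl⟩ := Finset.mem_image.1 hl
            obtain ⟨hwx, hws⟩ := Finset.mem_erase.1 hw
            have h1 : c w ∈ s.image c := Finset.mem_image_of_mem c hws
            rw [him] at h1
            refine (Finset.mem_insert.1 h1).resolve_left fun h => hwx ?_
            exact hinj hws hx (h.trans hcx.symm)
          · intro l hl
            obtain ⟨w, hw, rfl⟩ := Finset.mem_image.1 (hsub hl)
            refine Finset.mem_image_of_mem c (Finset.mem_erase.2 ⟨?_, hw⟩)
            rintro rfl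
            rw [hcx] at hl
            exact hjC hl

theorem outer_door {T I : Type*} [Fintype T] [Nonempty T] [DecidableEq T] [DecidableEq I]
    {k : I → T → ℕ} (hk : ∀ i, Function.Injective (k i)) (i : I) :
    ∃ r₁ : Finset T × Finset I, ∀ r, (Room k r ∧ Adj r (∅, {i})) ↔ r = r₁ := by
  obtain ⟨x, -, hx⟩ := Finset.exists_max_image (Finset.univ : Finset T) (k i) Finset.univ_nonempty
  refine ⟨({x}, {i}), fun r => ⟨?_, ?_⟩⟩
  · obtain ⟨s, C⟩ := r
    rintro ⟨⟨hdom, hcard⟩, ⟨y, hy, h⟩ | ⟨j, hj, h⟩⟩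
    · obtain ⟨h1, h2⟩ := Prod.mk.inj h
      simp only at hy h1 h2 hdom hcard
      subst h2
      have hs : s = {y} := by
        rw [← Finset.insert_erase hy, ← h1]; rfl
      subst hs
      obtain ⟨j, hj, hle⟩ := hdom x
      rw [Finset.mem_singleton] at hj
      subst hj
      have := hk j (le_antisymm (hle y (by simp)) (hx y (Finset.mem_univ _)))
      rw [this]
    · obtain ⟨h1, h2⟩ := Prod.mk.inj h
      simp only at hj h1 h2 hdom hcard
      subst h1
      have : C = ∅ := by rw [← Finset.card_eq_zero, ← hcard]; rfl
      subst this
      obtain ⟨j, hj, -⟩ := hdom x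
      simp at hj
  · rintro rfl
    refine ⟨⟨?_, by simp⟩, Or.inl ⟨x, by simp, by simp⟩⟩
    intro y
    exact ⟨i, by simp, fun z hz => by
      rw [Finset.mem_singleton.1 hz]; exact hx y (Finset.mem_univ _)⟩

theorem exists_colorful {T I : Type*} [Fintype T] [Nonempty T] [Fintype I] [Nonempty I]
    [DecidableEq T] [DecidableEq I]
    {k : I → T → ℕ} (hk : ∀ i, Function.Injective (k i)) (c : T → I) :
    ∃ (σ : Finset T) (C : Finset I), Dom k σ C ∧ σ.image c = C := by
  classical
  by_contra hcon
  push Not at hcon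
  obtain ⟨i⟩ := ‹Nonempty I›
  let R : Finset (Finset T × Finset I) := Finset.univ.filter (Room k)
  let DD : Finset (Finset T × Finset I) := Finset.univ.filter
    (fun d => Dom k d.1 d.2 ∧ d.2.card = d.1.card + 1 ∧ Door c i d)
  have hsum := Finset.sum_card_bipartiteAbove_eq_sum_card_bipartiteBelow
    (s := R) (t := DD) (r := Adj)
  have hA : ∀ r d, Room k r → Adj r d → Dom k d.1 d.2 ∧ d.2.card = d.1.card + 1 := by
    rintro r d ⟨hdom, hcard⟩ (⟨x, hx, rfl⟩ | ⟨j, hj, rfl⟩)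
    · refine ⟨fun y => ?_, ?_⟩
      · obtain ⟨l, hl, hle⟩ := hdom y
        exact ⟨l, hl, fun z hz => hle z (Finset.mem_erase.1 hz).2⟩
      · simp only
        rw [Finset.card_erase_add_one hx, hcard]
    · refine ⟨fun y => ?_, ?_⟩
      · obtain ⟨l, hl, hle⟩ := hdom y
        exact ⟨l, Finset.mem_insert_of_mem hl, hle⟩
      · simp only
        rw [Finset.card_insert_of_notMem hj, hcard]
  have hL : Even (∑ a ∈ R, (DD.bipartiteAbove Adj a).card) := by
    apply Finset.even_sum
    intro r hr
    have hr' : Room k r := (Finset.mem_filter.1 hr).2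
    have hmem : ∀ d, d ∈ DD.bipartiteAbove Adj r ↔ (Adj r d ∧ Door c i d) := by
      intro d
      rw [Finset.mem_bipartiteAbove]
      simp only [DD, Finset.mem_filter, Finset.mem_univ, true_and]
      constructor
      · rintro ⟨⟨_, _, h⟩, h'⟩; exact ⟨h', h⟩
      · rintro ⟨h', h⟩; exact ⟨⟨(hA r d hr' h').1, (hA r d hr' h').2, h⟩, h'⟩
    rcases room_even c i r hr'.2 (hcon r.1 r.2 hr'.1) with h | ⟨d₁, d₂, hne, h⟩
    · have : DD.bipartiteAbove Adj r = ∅ := by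
        apply Finset.eq_empty_of_forall_notMem
        intro d hd
        exact h d ((hmem d).1 hd)
      rw [this]; simp
    · have : DD.bipartiteAbove Adj r = {d₁, d₂} := by
        ext d
        rw [hmem, h]; simp
      rw [this, Finset.card_pair hne]
      exact even_two
  have hod : ((∅ : Finset T), ({i} : Finset I)) ∈ DD := by
    simp only [DD, Finset.mem_filter, Finset.mem_univ, true_and]
    refine ⟨fun y => ⟨i, by simp, by simp⟩, by simp, by simp, by simp⟩
  have hRt : Odd (∑ b ∈ DD, (R.bipartiteBelow Adj b).card) := by
    rw [← Finset.add_sum_erase DD _ hod]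
    apply Odd.add_even
    · obtain ⟨r₁, h⟩ := outer_door hk i
      have : R.bipartiteBelow Adj ((∅ : Finset T), ({i} : Finset I)) = {r₁} := by
        ext r
        rw [Finset.mem_bipartiteBelow, Finset.mem_singleton, ← h]
        simp [R]
      rw [this]; simp
    · apply Finset.even_sum
      rintro ⟨τ, D⟩ hd
      obtain ⟨hne, hd⟩ := Finset.mem_erase.1 hd
      simp only [DD, Finset.mem_filter, Finset.mem_univ, true_and] at hd
      obtain ⟨hdom, hcard, hi, him⟩ := hd
      simp only at hi him
      have hτ : τ.Nonempty := by
        rw [Finset.nonempty_iff_ne_empty]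
        rintro rfl
        apply hne
        have : D = {i} := by
          rw [← Finset.insert_erase hi, ← him]; rfl
        rw [this]
      obtain ⟨r₁, r₂, hne', h⟩ := door_two hk hdom hτ hcard
      have : R.bipartiteBelow Adj (τ, D) = {r₁, r₂} := by
        ext r
        rw [Finset.mem_bipartiteBelow, Finset.mem_insert, Finset.mem_singleton, ← h]
        simp [R]
      rw [this, Finset.card_pair hne']
      exact even_two
  rw [hsum] at hL
  exact (Nat.not_even_iff_odd.2 hRt) hL

end Scarf

namespace Brouwer

theorem grid_cell {I : Type*} [Fintype I] [Nonempty I] [DecidableEq I] (N : ℕ)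
    (c : {x : I → Fin (N + 1) // ∑ i, (x i : ℕ) = N} → I) :
    ∃ (σ : Finset {x : I → Fin (N + 1) // ∑ i, (x i : ℕ) = N}) (C : Finset I),
      σ.Nonempty ∧ σ.image c = C ∧
      (∀ x ∈ σ, ∀ x' ∈ σ, ∀ i, (x.1 i : ℕ) ≤ (x'.1 i : ℕ) + Fintype.card I) ∧
      (∀ x ∈ σ, ∀ i, i ∉ C → (x.1 i : ℕ) ≤ Fintype.card I) := by
  classical
  let T := {x : I → Fin (N + 1) // ∑ i, (x i : ℕ) = N}
  have mk : ∀ y : I → ℕ, ∑ i, y i = N → ∃ t : T, ∀ i, (t.1 i : ℕ) = y i := by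
    intro y hy
    have hle : ∀ i, y i < N + 1 := by
      intro i
      have := Finset.single_le_sum (f := y) (fun _ _ => Nat.zero_le _) (Finset.mem_univ i)
      omega
    exact ⟨⟨fun i => ⟨y i, hle i⟩, by simpa using hy⟩, fun i => rfl⟩
  have hT : Nonempty T := by
    obtain ⟨i⟩ := ‹Nonempty I›
    obtain ⟨t, -⟩ := mk (fun j => if j = i then N else 0) (by simp)
    exact ⟨t⟩
  let B := Fintype.card T
  let e : T ≃ Fin B := Fintype.equivFin T
  let k : I → T → ℕ := fun i x => (e x : ℕ) + B * (x.1 i : ℕ)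
  have hk : ∀ i, Function.Injective (k i) := by
    intro i x y hxy
    have h1 : k i x % B = k i y % B := by rw [hxy]
    simp only [k, Nat.add_mul_mod_self_left, Nat.mod_eq_of_lt (e x).2, Nat.mod_eq_of_lt (e y).2] at h1
    exact e.injective (Fin.ext h1)
  obtain ⟨σ, C, hdom, him⟩ := Scarf.exists_colorful hk c
  have hCne : C.Nonempty := by
    obtain ⟨t⟩ := hT
    obtain ⟨i, hi, -⟩ := hdom t
    exact ⟨i, hi⟩
  have hσ : σ.Nonempty := by
    rw [← him] at hCne
    exact Finset.image_nonempty.1 hCne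
  have h0 : ∀ i : I, ∃ x ∈ σ, ∀ x' ∈ σ, (x.1 i : ℕ) ≤ (x'.1 i : ℕ) :=
    fun i => Finset.exists_min_image σ (fun x => (x.1 i : ℕ)) hσ
  choose μ hμ hmin using h0
  let m : I → ℕ := fun i => ((μ i).1 i : ℕ)
  have hm : ∀ i, ∀ x ∈ σ, m i ≤ (x.1 i : ℕ) := hmin
  have hsum : N < ∑ i ∈ C, (m i + 1) := by
    by_contra hcon
    push Not at hcon
    obtain ⟨i0, hi0⟩ := hCne
    obtain ⟨t, ht⟩ := mk (fun i => (if i ∈ C then m i + 1 else 0) +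
        (if i = i0 then N - ∑ i ∈ C, (m i + 1) else 0)) (by
      rw [Finset.sum_add_distrib, Finset.sum_ite_mem, Finset.univ_inter]
      simp only [Finset.sum_ite_eq', Finset.mem_univ, if_true]
      omega)
    obtain ⟨i, hi, hle⟩ := hdom t
    have h1 := hle (μ i) (hμ i)
    have h2 : m i + 1 ≤ (t.1 i : ℕ) := by rw [ht]; simp [hi]
    have h3 := Nat.mul_le_mul_left B h2
    have h4 := (e (μ i)).2
    simp only [k] at h1
    have h5 : B * (m i + 1) = B * m i + B := by ring
    have h6 : B * ((μ i).1 i : ℕ) = B * m i := rfl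
    omega
  have hsum' : N < ∑ i ∈ C, m i + C.card := by
    rw [Finset.sum_add_distrib] at hsum
    simpa using hsum
  have hcard : C.card ≤ Fintype.card I := Finset.card_le_univ C
  have hA : ∀ x ∈ σ, ∀ i ∈ C, (x.1 i : ℕ) ≤ m i + Fintype.card I := by
    intro x hx i hi
    have h1 : ∑ j ∈ C, (x.1 j : ℕ) ≤ N := by
      exact (Finset.sum_le_sum_of_subset (Finset.subset_univ C)).trans x.2.le
    have h2 : ∑ j ∈ C.erase i, m j ≤ ∑ j ∈ C.erase i, (x.1 j : ℕ) :=
      Finset.sum_le_sum fun j _ => hm j x hx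
    have h3 := Finset.add_sum_erase C m hi
    have h4 := Finset.add_sum_erase C (fun j => (x.1 j : ℕ)) hi
    omega
  have hB : ∀ x ∈ σ, ∀ i, i ∉ C → (x.1 i : ℕ) ≤ Fintype.card I := by
    intro x hx i hi
    have h1 : ∑ j ∈ insert i C, (x.1 j : ℕ) ≤ N := by
      exact (Finset.sum_le_sum_of_subset (Finset.subset_univ _)).trans x.2.le
    rw [Finset.sum_insert hi] at h1
    have h2 : ∑ j ∈ C, m j ≤ ∑ j ∈ C, (x.1 j : ℕ) :=
      Finset.sum_le_sum fun j _ => hm j x hx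
    omega
  refine ⟨σ, C, hσ, him, ?_, hB⟩
  intro x hx x' hx' i
  by_cases hi : i ∈ C
  · have := hA x hx i hi
    have := hm i x' hx'
    omega
  · have := hB x hx i hi
    omega

theorem approx {I : Type*} [Fintype I] [Nonempty I] (F : (I → ℝ) → (I → ℝ))
    (hF : ContinuousOn F (stdSimplex ℝ I)) (hmaps : ∀ x ∈ stdSimplex ℝ I, F x ∈ stdSimplex ℝ I)
    {ε : ℝ} (hε : 0 < ε) : ∃ x ∈ stdSimplex ℝ I, ∀ i, x i - ε ≤ F x i := by
  classical
  have huc := (isCompact_stdSimplex ℝ I).uniformContinuousOn_of_continuous hF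
  rw [Metric.uniformContinuousOn_iff] at huc
  obtain ⟨δ, hδ, huc⟩ := huc (ε / 2) (by linarith)
  obtain ⟨N, hN⟩ := exists_nat_gt ((Fintype.card I : ℝ) / min δ (ε / 2))
  have hmpos : 0 < min δ (ε / 2) := lt_min hδ (by linarith)
  have hNpos : (0 : ℝ) < N := lt_of_le_of_lt (by positivity) hN
  have hsmall : (Fintype.card I : ℝ) / N < min δ (ε / 2) := by
    rw [div_lt_iff₀ hmpos] at hN
    rw [div_lt_iff₀ hNpos]; linarith
  let p : {x : I → Fin (N + 1) // ∑ i, (x i : ℕ) = N} → I → ℝ := fun x i => ((x.1 i : ℕ) : ℝ) / N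
  have hp : ∀ x, p x ∈ stdSimplex ℝ I := by
    intro x
    refine ⟨fun i => by positivity, ?_⟩
    simp only [p]
    rw [← Finset.sum_div, ← Nat.cast_sum, x.2, div_self hNpos.ne']
  have hc : ∀ x, ∃ i, p x i ≤ F (p x) i := by
    intro x
    by_contra hcon
    push Not at hcon
    have h1 := Finset.sum_lt_sum_of_nonempty (Finset.univ_nonempty (α := I)) (fun i _ => hcon i)
    rw [(hp x).2, (hmaps _ (hp x)).2] at h1
    exact lt_irrefl _ h1
  choose c hc using hc
  obtain ⟨σ, C, ⟨x, hx⟩, him, hA, hB⟩ := grid_cell N c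
  have hAA : ∀ x ∈ σ, ∀ x' ∈ σ, ∀ i, p x i ≤ p x' i + (Fintype.card I : ℝ) / N := by
    intro x hx x' hx' i
    simp only [p]
    rw [← add_div]
    apply div_le_div_of_nonneg_right _ hNpos.le
    exact_mod_cast hA x hx x' hx' i
  refine ⟨p x, hp x, fun i => ?_⟩
  by_cases hi : i ∈ C
  · rw [← him] at hi
    obtain ⟨x', hx', rfl⟩ := Finset.mem_image.1 hi
    have hd : dist (p x') (p x) < δ := by
      rw [dist_pi_lt_iff hδ]
      intro j
      have h1 := hAA x hx x' hx' j
      have h2 := hAA x' hx' x hx j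
      have h3 := hsmall.trans_le (min_le_left _ _)
      rw [Real.dist_eq, abs_lt]
      constructor <;> linarith
    have h1 := huc _ (hp x') _ (hp x) hd
    have h2 := (dist_le_pi_dist (F (p x')) (F (p x)) (c x')).trans_lt h1
    rw [Real.dist_eq, abs_lt] at h2
    have h3 := hsmall.trans_le (min_le_right _ _)
    have h4 := hAA x hx x' hx' (c x')
    have h5 := hc x'
    linarith [h2.1, h2.2]
  · have h1 : p x i ≤ (Fintype.card I : ℝ) / N := by
      simp only [p]
      apply div_le_div_of_nonneg_right _ hNpos.le
      exact_mod_cast hB x hx i hi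
    have h3 := hsmall.trans_le (min_le_right _ _)
    have h4 := (hmaps _ (hp x)).1 i
    linarith

theorem fixed {I : Type*} [Fintype I] [Nonempty I] (F : (I → ℝ) → (I → ℝ))
    (hF : ContinuousOn F (stdSimplex ℝ I)) (hmaps : ∀ x ∈ stdSimplex ℝ I, F x ∈ stdSimplex ℝ I) :
    ∃ x ∈ stdSimplex ℝ I, F x = x := by
  classical
  have hne : (stdSimplex ℝ I).Nonempty := by
    obtain ⟨x, hx, -⟩ := approx F hF hmaps one_pos
    exact ⟨x, hx⟩
  have hcont : ContinuousOn (fun x : I → ℝ => dist (F x) x) (stdSimplex ℝ I) :=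
    continuous_dist.comp_continuousOn (hF.prodMk continuousOn_id)
  obtain ⟨x, hx, hmin⟩ := (isCompact_stdSimplex ℝ I).exists_isMinOn hne hcont
  refine ⟨x, hx, ?_⟩
  by_contra hxne
  have hpos : 0 < dist (F x) x := dist_pos.2 hxne
  have hcardpos : (0 : ℝ) < Fintype.card I := by exact_mod_cast Fintype.card_pos
  obtain ⟨y, hy, hle⟩ := approx F hF hmaps
    (show 0 < dist (F x) x / (2 * Fintype.card I) by positivity)
  set η := dist (F x) x / (2 * Fintype.card I) with hη
  have h1 : dist (F x) x ≤ dist (F y) y := hmin hy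
  have h2 : dist (F y) y ≤ Fintype.card I * η := by
    rw [dist_pi_le_iff (by positivity)]
    intro i
    have hη0 : 0 ≤ η := by positivity
    have hc1 : (1 : ℝ) ≤ Fintype.card I := by exact_mod_cast Fintype.card_pos
    have h3 : ∑ j, (F y j - y j + η) = Fintype.card I * η := by
      rw [Finset.sum_add_distrib, Finset.sum_sub_distrib, (hmaps y hy).2, hy.2]
      simp
    have h4 : F y i - y i + η ≤ ∑ j, (F y j - y j + η) :=
      Finset.single_le_sum (f := fun j => F y j - y j + η)
        (fun j _ => by have := hle j; linarith) (Finset.mem_univ i)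
    have h5 := hle i
    rw [Real.dist_eq, abs_le]
    constructor
    · nlinarith
    · linarith
  have h6 : Fintype.card I * η = dist (F x) x / 2 := by
    rw [hη]; field_simp
  linarith

theorem fixed' {I : Type*} [Fintype I] [Nonempty I] (G : stdSimplex ℝ I → (I → ℝ))
    (hG : Continuous G) (hmaps : ∀ x, G x ∈ stdSimplex ℝ I) :
    ∃ x : stdSimplex ℝ I, G x = x.1 := by
  classical
  let F : (I → ℝ) → (I → ℝ) := fun x => if h : x ∈ stdSimplex ℝ I then G ⟨x, h⟩ else 0
  have hFG : ∀ x : stdSimplex ℝ I, F x.1 = G x := fun x => dif_pos x.2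
  obtain ⟨x, hx, h⟩ := fixed F (by
      rw [continuousOn_iff_continuous_domRestrict]
      exact hG.congr fun x => (hFG x).symm) (fun x hx => by
      have := hmaps ⟨x, hx⟩
      rwa [← hFG ⟨x, hx⟩] at this)
  exact ⟨⟨x, hx⟩, by rw [← hFG]; exact h⟩

end Brouwer

theorem approx_pair {V : Type*} [NormedAddCommGroup V] [NormedSpace ℝ V]
    (U : Set V) (hUne : U.Nonempty) (hUcv : Convex ℝ U)
    (K : ↥U → Set V)
    (hKusc : ∀ u : ↥U, ∀ W : Set V, IsOpen W → K u ⊆ W → ∀ᶠ u' in 𝓝 u, K u' ⊆ W)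
    (hKlsc : ∀ u : ↥U, ∀ W : Set V, IsOpen W → (K u ∩ W).Nonempty →
      ∀ᶠ u' in 𝓝 u, (K u' ∩ W).Nonempty)
    (hKne : ∀ u, (K u).Nonempty) (hKcl : ∀ u, IsClosed (K u))
    (hKcv : ∀ u, Convex ℝ (K u))
    (hKcpt : IsCompact (closure (⋃ u : ↥U, K u)))
    (f : V → ℝ) (hfc : Continuous f)
    (hfq : ∀ a b : V, ∀ t : ℝ, 0 ≤ t → t ≤ 1 → min (f a) (f b) ≤ f (t • a + (1 - t) • b))
    {ε : ℝ} (hε : 0 < ε) :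
    ∃ (u : ↥U) (v z : V), dist v u < Metric.infDist v U + ε ∧ z ∈ K u ∧ dist v z < ε ∧
      ∀ w ∈ K u, f w < f v + ε := by
  classical
  set C := closure (⋃ u : ↥U, K u) with hC
  have hKC : ∀ u, K u ⊆ C := fun u => (subset_iUnion K u).trans subset_closure
  have huc := hKcpt.uniformContinuousOn_of_continuous hfc.continuousOn
  rw [Metric.uniformContinuousOn_iff] at huc
  obtain ⟨δ, hδ, huc⟩ := huc ε hε
  obtain ⟨t, htC, htcov⟩ := hKcpt.elim_nhds_subcover (fun x => Metric.ball x (min δ ε))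
    (fun x _ => Metric.ball_mem_nhds x (lt_min hδ hε))
  -- the open cover of `U`
  let O : ↥t → Set ↥U := fun c =>
    {u | (K u ∩ Metric.ball (c : V) ε).Nonempty ∧ K u ⊆ {w | f w < f c + ε}}
  have hO : ∀ c, IsOpen (O c) := by
    intro c
    rw [isOpen_iff_mem_nhds]
    rintro u ⟨h1, h2⟩
    exact (hKlsc u _ Metric.isOpen_ball h1).and
      (hKusc u _ (isOpen_lt hfc continuous_const) h2)
  have hcov : ∀ u, ∃ c, u ∈ O c := by
    intro u
    obtain ⟨x, hx, hmax⟩ := (hKcpt.of_isClosed_subset (hKcl u) (hKC u)).exists_isMaxOn (hKne u)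
      hfc.continuousOn
    obtain ⟨c, hct, hxc⟩ := mem_iUnion₂.1 (htcov (hKC u hx))
    have hxc' := Metric.mem_ball.1 hxc
    refine ⟨⟨c, hct⟩, ⟨x, hx, Metric.mem_ball.2 (hxc'.trans_le (min_le_right _ _))⟩, ?_⟩
    intro w hw
    have h1 : f w ≤ f x := hmax hw
    have h2 := huc x (hKC u hx) c (htC c hct) (hxc'.trans_le (min_le_left _ _))
    rw [Real.dist_eq, abs_lt] at h2
    show f w < f c + ε
    linarith [h2.2]
  obtain ⟨u0, hu0⟩ := hUne
  have hne : Nonempty ↥t := ⟨(hcov ⟨u0, hu0⟩).choose⟩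
  obtain ⟨ρ, hρ⟩ := PartitionOfUnity.exists_isSubordinate_of_locallyFinite
    (s := (univ : Set ↥U)) isClosed_univ O hO (locallyFinite_of_finite O)
    (fun u _ => mem_iUnion.2 (hcov u))
  -- the polytope
  let L : stdSimplex ℝ ↥t → V := fun s => ∑ c, s.1 c • (c : V)
  have hL : Continuous L := by
    apply continuous_finsetSum
    intro c _
    exact ((continuous_apply c).comp continuous_subtype_val).smul continuous_const
  have : CompactSpace (stdSimplex ℝ ↥t) := isCompact_iff_compactSpace.1 (isCompact_stdSimplex ℝ ↥t)
  have hQ : IsCompact (range L) := isCompact_range hL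
  let W : ↥U → Set V := fun d => {v | dist v d < Metric.infDist v U + ε}
  have hW : ∀ d, IsOpen (W d) := fun d =>
    isOpen_lt (continuous_id.dist continuous_const)
      ((Metric.continuous_infDist_pt U).add continuous_const)
  have hWcov : range L ⊆ ⋃ d, W d := by
    intro v _
    obtain ⟨d, hd, hlt⟩ := (Metric.infDist_lt_iff ⟨u0, hu0⟩).1
      (show Metric.infDist v U < Metric.infDist v U + ε by linarith)
    exact mem_iUnion.2 ⟨⟨d, hd⟩, hlt⟩
  obtain ⟨t', ht'⟩ := hQ.elim_finite_subcover W hW hWcov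
  obtain ⟨ρ', hρ'⟩ := PartitionOfUnity.exists_isSubordinate_of_locallyFinite
    (s := range L) hQ.isClosed (fun d : ↥t' => W d) (fun d => hW d) (locallyFinite_of_finite _)
    (fun v hv => by
      obtain ⟨d, hd, h⟩ := mem_iUnion₂.1 (ht' hv)
      exact mem_iUnion.2 ⟨⟨d, hd⟩, h⟩)
  let p : V → V := fun v => ∑ d : ↥t', ρ' d v • ((d : ↥U) : V)
  have hp : Continuous p := by
    apply continuous_finsetSum
    intro d _
    exact (ρ' d).continuous.smul continuous_const
  have hpm : ∀ v ∈ range L, p v ∈ U ∩ Metric.ball v (Metric.infDist v U + ε) := by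
    intro v hv
    have h := ρ'.finsum_smul_mem_convex (g := fun d _ => ((d : ↥U) : V)) hv
      (t := U ∩ Metric.ball v (Metric.infDist v U + ε)) (fun d hd => ?_)
      (hUcv.inter (convex_ball _ _))
    · rwa [finsum_eq_sum_of_fintype] at h
    · refine ⟨d.1.2, ?_⟩
      have : v ∈ W d := hρ' d (subset_tsupport _ hd)
      rw [Metric.mem_ball, dist_comm]
      exact this
  let g : stdSimplex ℝ ↥t → ↥U := fun s => ⟨p (L s), (hpm _ ⟨s, rfl⟩).1⟩
  have hg : Continuous g := (hp.comp hL).subtype_mk _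
  obtain ⟨s, hs⟩ := Brouwer.fixed' (fun s c => ρ c (g s))
    (continuous_pi fun c => (ρ c).continuous.comp hg) (fun s => by
      refine ⟨fun c => ρ.nonneg c _, ?_⟩
      have := ρ.sum_eq_one (mem_univ (g s))
      rwa [finsum_eq_sum_of_fintype] at this)
  have hcvx : Convex ℝ (Metric.thickening ε (K (g s)) ∩ {q | ∀ w ∈ K (g s), f w < f q + ε}) := by
    refine ((hKcv (g s)).thickening ε).inter ?_
    intro x hx y hy a b ha hb hab w hw
    have hb' : b = 1 - a := by linarith
    subst hb'
    have h1 := hfq x y a ha (by linarith)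
    have h2 := hx w hw
    have h3 := hy w hw
    rcases min_choice (f x) (f y) with h | h <;> rw [h] at h1 <;> linarith
  have hmem := ρ.finsum_smul_mem_convex (g := fun c _ => (c : V)) (mem_univ (g s))
      (fun c hc => ?_) hcvx
  · rw [finsum_eq_sum_of_fintype] at hmem
    have hLs : ∑ c, ρ c (g s) • (c : V) = L s := by
      simp only [L]
      rw [← hs]
    rw [hLs] at hmem
    obtain ⟨z, hz, hdz⟩ := Metric.mem_thickening_iff.1 hmem.1
    refine ⟨g s, L s, z, ?_, hz, hdz, hmem.2⟩
    have := (hpm _ ⟨s, rfl⟩).2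
    rw [Metric.mem_ball, dist_comm] at this
    exact this
  · have h : g s ∈ O c := hρ c (subset_tsupport _ hc)
    obtain ⟨⟨z, hz, hzc⟩, h2⟩ := h
    refine ⟨Metric.mem_thickening_iff.2 ⟨z, hz, ?_⟩, fun w hw => h2 hw⟩
    rw [dist_comm]; exact hzc

/-- The composition `Γ = Pr ∘ M` of the best approximation map with the maximizing map of
a continuous quasi-concave function over a continuous non-self constraint map has a
fixed point. -/
theorem stmt14 {V : Type*} [NormedAddCommGroup V] [NormedSpace ℝ V]
    (U : Set V) (hUne : U.Nonempty) (hUcv : Convex ℝ U)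
    (hAC : ∀ v : V, ∀ u : ℕ → V, (∀ n, u n ∈ U) →
      Tendsto (fun n => ‖v - u n‖) atTop (𝓝 (⨅ w : U, ‖v - (w : V)‖)) →
      ∃ φ : ℕ → ℕ, StrictMono φ ∧ ∃ l ∈ U, Tendsto (u ∘ φ) atTop (𝓝 l))
    (K : ↥U → Set V)
    (hKusc : ∀ u : ↥U, ∀ W : Set V, IsOpen W → K u ⊆ W → ∀ᶠ u' in 𝓝 u, K u' ⊆ W)
    (hKlsc : ∀ u : ↥U, ∀ W : Set V, IsOpen W → (K u ∩ W).Nonempty →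
      ∀ᶠ u' in 𝓝 u, (K u' ∩ W).Nonempty)
    (hKne : ∀ u, (K u).Nonempty) (hKcl : ∀ u, IsClosed (K u))
    (hKcv : ∀ u, Convex ℝ (K u))
    (hKcpt : IsCompact (closure (⋃ u : ↥U, K u)))
    (f : V → ℝ) (hfc : Continuous f)
    (hfq : ∀ a b : V, ∀ t : ℝ, 0 ≤ t → t ≤ 1 → min (f a) (f b) ≤ f (t • a + (1 - t) • b))
    (M : ↥U → Set V) (hM : ∀ u, M u = {v ∈ K u | ∀ w ∈ K u, f w ≤ f v})
    (Pr : V → Set V) (hPr : ∀ v, Pr v = {x ∈ U | ‖v - x‖ = ⨅ w : U, ‖v - (w : V)‖}) :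
    ∃ u : ↥U, (u : V) ∈ ⋃ v ∈ M u, Pr v := by
  have hinf : ∀ v : V, (⨅ w : U, ‖v - (w : V)‖) = Metric.infDist v U := by
    intro v
    rw [Metric.infDist_eq_iInf]
    simp only [dist_eq_norm]
  simp only [hinf] at hAC hPr
  have happ : ∀ n : ℕ, ∃ (u : ↥U) (v z : V), dist v u < Metric.infDist v U + 1 / ((n : ℝ) + 1) ∧
      z ∈ K u ∧ dist v z < 1 / ((n : ℝ) + 1) ∧ ∀ w ∈ K u, f w < f v + 1 / ((n : ℝ) + 1) :=
    fun n => approx_pair U hUne hUcv K hKusc hKlsc hKne hKcl hKcv hKcpt f hfc hfq (by positivity)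
  choose u v z h1 h2 h3 h4 using happ
  have he : Tendsto (fun n : ℕ => 1 / ((n : ℝ) + 1)) atTop (𝓝 0) :=
    tendsto_one_div_add_atTop_nhds_zero_nat
  obtain ⟨v0, -, φ, hφ, hz⟩ := hKcpt.tendsto_subseq
    (x := z) (fun n => subset_closure (mem_iUnion.2 ⟨u n, h2 n⟩))
  have heφ := he.comp hφ.tendsto_atTop
  have hv : Tendsto (v ∘ φ) atTop (𝓝 v0) := by
    rw [tendsto_iff_dist_tendsto_zero] at hz ⊢
    refine squeeze_zero (fun _ => dist_nonneg) (fun n => ?_) (by rw [← zero_add (0 : ℝ)]; exact heφ.add hz)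
    exact (dist_triangle _ (z (φ n)) _).trans (add_le_add (h3 (φ n)).le le_rfl)
  have hd : Tendsto (fun n => ‖v0 - (u (φ n) : V)‖) atTop (𝓝 (Metric.infDist v0 U)) := by
    have hup : Tendsto (fun n => dist (v (φ n)) v0 + (Metric.infDist (v (φ n)) U
        + 1 / ((φ n : ℝ) + 1))) atTop (𝓝 (Metric.infDist v0 U)) := by
      have a1 := tendsto_iff_dist_tendsto_zero.1 hv
      have a2 := ((Metric.continuous_infDist_pt U).tendsto v0).comp hv
      simpa using a1.add (a2.add heφ)
    refine tendsto_of_tendsto_of_tendsto_of_le_of_le tendsto_const_nhds hup ?_ ?_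
    · intro n
      simp only [← dist_eq_norm]
      exact Metric.infDist_le_dist_of_mem (u (φ n)).2
    · intro n
      simp only [← dist_eq_norm]
      rw [dist_comm (v (φ n)) v0]
      exact (dist_triangle _ (v (φ n)) _).trans (add_le_add le_rfl (h1 (φ n)).le)
  obtain ⟨ψ, hψ, l, hl, hul⟩ := hAC v0 (fun n => (u (φ n) : V)) (fun n => (u (φ n)).2) hd
  have hU : Tendsto (fun n => u (φ (ψ n))) atTop (𝓝 (⟨l, hl⟩ : ↥U)) :=
    tendsto_subtype_rng.2 hul
  have hvψ := hv.comp hψ.tendsto_atTop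
  have hzψ := hz.comp hψ.tendsto_atTop
  have heψ := heφ.comp hψ.tendsto_atTop
  refine ⟨⟨l, hl⟩, mem_iUnion₂.2 ⟨v0, ?_, ?_⟩⟩
  · have hvK : v0 ∈ K ⟨l, hl⟩ := by
      by_contra hcon
      obtain ⟨r, hr, hball⟩ := Metric.isOpen_iff.1 (hKcl ⟨l, hl⟩).isOpen_compl v0 hcon
      have hW : IsOpen (Metric.closedBall v0 (r / 2))ᶜ := Metric.isClosed_closedBall.isOpen_compl
      have hsub : K ⟨l, hl⟩ ⊆ (Metric.closedBall v0 (r / 2))ᶜ := by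
        intro x hx hx'
        exact hball (Metric.closedBall_subset_ball (by linarith) hx') hx
      have e1 := hU.eventually (hKusc _ _ hW hsub)
      have e2 := hzψ.eventually (Metric.closedBall_mem_nhds v0 (show 0 < r / 2 by linarith))
      obtain ⟨n, hn1, hn2⟩ := (e1.and e2).exists
      exact hn1 (h2 _) hn2
    rw [hM]
    refine ⟨hvK, fun w hw => ?_⟩
    by_contra hcon
    push Not at hcon
    obtain ⟨c, hc1, hc2⟩ := exists_between hcon
    have e1 := hU.eventually (hKlsc _ {x | c < f x} (isOpen_lt continuous_const hfc) ⟨w, hw, hc2⟩)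
    have e2 : Tendsto (fun n => f (v (φ (ψ n))) + 1 / ((φ (ψ n) : ℝ) + 1)) atTop (𝓝 (f v0)) := by
      simpa using ((hfc.tendsto v0).comp hvψ).add heψ
    obtain ⟨n, ⟨x, hx, hcx⟩, hn2⟩ := (e1.and (e2.eventually (gt_mem_nhds hc1))).exists
    have := h4 _ x hx
    have hcx' : c < f x := hcx
    linarith
  · rw [hPr]
    refine ⟨hl, ?_⟩
    have a1 : Tendsto (fun n => ‖v0 - (u (φ (ψ n)) : V)‖) atTop (𝓝 ‖v0 - l‖) :=
      (tendsto_const_nhds.sub hul).norm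
    exact tendsto_nhds_unique a1 (hd.comp hψ.tendsto_atTop)
end
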